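/- arXiv:2401.16892 — 13 statements merged into one kernel-verified Lean document; each statement's English description precedes it below -/
import Mathlib

section
/- Let m and n be coprime positive integers such that every finite solvable group of order m·n has a normal subgroup of order m. Let B be a left brace of cardinality m·n. Then B is a semidirect product of a brace of size m and a brace of size n. Concretely: there exist subsets B1, B2 of B with |B1| = m and |B2| = n, each of which is an additive subgroup of (B,+) and closed under ∘ and ∘-inversion, such that (i) the map B1 × B2 → B, (a,b) ↦ a + b, is a bijection; (ii) for every b ∈ B2 the map a ↦ λ_b(a) = -b + b∘a sends B1 to B1 and its restriction to B1 is a brace automorphism of B1 (a bijection of B1 preserving both + and ∘); (iii) for all a, a' ∈ B1 and b, b' ∈ B2 one has (a+b) ∘ (a'+b') = (a ∘ λ_b(a')) + (b ∘ b'). -/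
/-- A left brace structure on an additive commutative group `B`: a second group
operation `circ` (with inverse `inv` and identity `0`) satisfying the left brace
compatibility law `a ∘ (b + c) + a = a ∘ b + a ∘ c`. -/
structure BraceMul (B : Type*) [AddCommGroup B] where
  circ : B → B → B
  inv : B → B
  circ_assoc : ∀ a b c, circ (circ a b) c = circ a (circ b c)
  zero_circ : ∀ a, circ 0 a = a
  circ_zero : ∀ a, circ a 0 = a
  inv_circ : ∀ a, circ (inv a) a = 0
  circ_inv : ∀ a, circ a (inv a) = 0
  compat : ∀ a b c, circ a (b + c) + a = circ a b + circ a c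

/-- The lambda map of a left brace: `λ_a(b) = -a + a ∘ b`. -/
def BraceMul.lam {B : Type*} [AddCommGroup B] (br : BraceMul B) (a b : B) : B :=
  -a + br.circ a b

/-- The multiplicative group of a left brace. -/
def BraceMul.mulGroup {B : Type*} [AddCommGroup B] (br : BraceMul B) : Group B :=
  letI : Mul B := ⟨br.circ⟩
  letI : One B := ⟨(0 : B)⟩
  letI : Inv B := ⟨br.inv⟩
  Group.ofLeftAxioms br.circ_assoc br.zero_circ br.inv_circ

namespace BraceMul

variable {B : Type*} [AddCommGroup B] (br : BraceMul B)

theorem circ_eq_add_lam (a b : B) : br.circ a b = a + br.lam a b := by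
  simp [lam]

theorem lam_add (a b c : B) : br.lam a (b + c) = br.lam a b + br.lam a c := by
  have h := eq_sub_of_add_eq (br.compat a b c)
  simp only [lam, h]
  abel

/-- The map `λ_a` as an endomorphism of the additive group. -/
def lamHom (a : B) : B →+ B := AddMonoidHom.mk' (br.lam a) (br.lam_add a)

theorem lam_nsmul (k : ℕ) (a b : B) : br.lam a (k • b) = k • br.lam a b :=
  map_nsmul (br.lamHom a) k b

theorem lam_neg (a b : B) : br.lam a (-b) = -br.lam a b :=
  map_neg (br.lamHom a) b

theorem lam_circ (a b c : B) : br.lam (br.circ a b) c = br.lam a (br.lam b c) := by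
  have h : br.lam b c = -b + br.circ b c := rfl
  rw [h, lam_add, lam_neg]
  simp only [lam, circ_assoc]
  abel

theorem zero_lam (a : B) : br.lam 0 a = a := by
  simp [lam, zero_circ]

theorem lam_inv_lam (a b : B) : br.lam (br.inv a) (br.lam a b) = b := by
  rw [← lam_circ, inv_circ, zero_lam]

theorem lam_lam_inv (a b : B) : br.lam a (br.lam (br.inv a) b) = b := by
  rw [← lam_circ, circ_inv, zero_lam]

theorem inv_eq_neg_lam (a : B) : br.inv a = -br.lam (br.inv a) a := by
  simp [lam, inv_circ]

theorem circ_right_cancel {a b c : B} (h : br.circ a c = br.circ b c) : a = b := by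
  have := congrArg (fun x => br.circ x (br.inv c)) h
  simpa only [circ_assoc, circ_inv, circ_zero] using this

/-- The additive `k`-torsion of a left brace. -/
def torsion (B : Type*) [AddCommGroup B] (k : ℕ) : AddSubgroup B :=
  (nsmulAddMonoidHom k : B →+ B).ker

theorem mem_torsion {k : ℕ} {a : B} : a ∈ torsion B k ↔ k • a = 0 := Iff.rfl

variable {br} in
theorem lam_mem_torsion {k : ℕ} (a : B) {b : B} (hb : b ∈ torsion B k) :
    br.lam a b ∈ torsion B k := by
  rw [mem_torsion] at hb ⊢
  rw [← lam_nsmul, hb]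
  exact map_zero (br.lamHom a)

variable {br} in
theorem circ_mem_torsion {k : ℕ} {a b : B} (ha : a ∈ torsion B k) (hb : b ∈ torsion B k) :
    br.circ a b ∈ torsion B k := by
  rw [circ_eq_add_lam]
  exact add_mem ha (lam_mem_torsion a hb)

variable {br} in
theorem inv_mem_torsion {k : ℕ} {a : B} (ha : a ∈ torsion B k) :
    br.inv a ∈ torsion B k := by
  rw [inv_eq_neg_lam]
  exact neg_mem (lam_mem_torsion _ ha)

theorem bijOn_lam_torsion (k : ℕ) (a : B) :
    Set.BijOn (br.lam a) (torsion B k : Set B) (torsion B k : Set B) :=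
  Set.InvOn.bijOn (f' := br.lam (br.inv a))
    ⟨fun b _ => br.lam_inv_lam a b, fun b _ => br.lam_lam_inv a b⟩
    (fun _ hb => lam_mem_torsion _ hb) (fun _ hb => lam_mem_torsion _ hb)

/-- The additive `k`-torsion as a subgroup of the multiplicative group. -/
def torsionSubgroup (k : ℕ) : @Subgroup B br.mulGroup :=
  letI := br.mulGroup
  { carrier := torsion B k
    mul_mem' := fun ha hb => circ_mem_torsion ha hb
    one_mem' := zero_mem (torsion B k)
    inv_mem' := fun ha => inv_mem_torsion ha }

theorem disjoint_torsion {m n : ℕ} (hmn : m.Coprime n) {a : B} (ha : a ∈ torsion B m)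
    (ha' : a ∈ torsion B n) : a = 0 := by
  rw [mem_torsion, ← addOrderOf_dvd_iff_nsmul_eq_zero] at ha ha'
  exact AddMonoid.addOrderOf_eq_one_iff.mp (Nat.eq_one_of_dvd_coprimes hmn ha ha')

theorem eq_and_eq_of_add_eq_add {m n : ℕ} (hmn : m.Coprime n) {a a' b b' : B}
    (ha : a ∈ torsion B m) (ha' : a' ∈ torsion B m) (hb : b ∈ torsion B n)
    (hb' : b' ∈ torsion B n) (h : a + b = a' + b') : a = a' ∧ b = b' := by
  have h1 : a - a' = b' - b := by
    rw [sub_eq_sub_iff_add_eq_add, h, add_comm]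
  have h2 := disjoint_torsion hmn (sub_mem ha ha') (h1 ▸ sub_mem hb' hb)
  exact ⟨sub_eq_zero.mp h2, (sub_eq_zero.mp (h1 ▸ h2)).symm⟩

theorem bijective_torsion_add {m n : ℕ} (hmn : m.Coprime n) (hcard : Nat.card B = m * n) :
    Function.Bijective
      (fun x : torsion B m × torsion B n => (x.1 : B) + (x.2 : B)) := by
  constructor
  · rintro ⟨a, b⟩ ⟨a', b'⟩ h
    obtain ⟨h1, h2⟩ := eq_and_eq_of_add_eq_add hmn a.2 a'.2 b.2 b'.2 h
    exact Prod.ext (Subtype.ext h1) (Subtype.ext h2)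
  · intro x
    have hx : (m * n) • x = 0 := hcard ▸ card_nsmul_eq_zero'
    have hbez : (m : ℤ) * m.gcdA n + n * m.gcdB n = 1 := by
      rw [← Nat.gcd_eq_gcd_ab, hmn.gcd_eq_one, Nat.cast_one]
    refine ⟨(⟨m.gcdB n • n • x, ?_⟩, ⟨m.gcdA n • m • x, ?_⟩), ?_⟩
    · refine zsmul_mem ?_ _
      rw [mem_torsion, ← mul_nsmul', hx]
    · refine zsmul_mem ?_ _
      rw [mem_torsion, ← mul_nsmul', mul_comm, hx]
    · simp only [← natCast_zsmul, ← mul_zsmul', ← add_zsmul]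
      rw [add_comm, hbez, one_zsmul]

theorem coprime_card_torsion [Finite B] {m n : ℕ} (hmn : m.Coprime n) :
    (Nat.card (torsion B m)).Coprime n := by
  refine Nat.Coprime.symm (Nat.coprime_of_dvd fun p hp hpn hpc => ?_)
  have : Fact p.Prime := ⟨hp⟩
  obtain ⟨x, hx⟩ := exists_prime_addOrderOf_dvd_card' p hpc
  have hpm : p ∣ m := hx ▸ addOrderOf_dvd_of_nsmul_eq_zero (Subtype.ext x.2)
  exact hp.one_lt.ne' (Nat.eq_one_of_dvd_coprimes hmn hpm hpn)

theorem card_torsion [Finite B] {m n : ℕ} (hm : 0 < m) (hmn : m.Coprime n)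
    (hcard : Nat.card B = m * n) :
    Nat.card (torsion B m) = m ∧ Nat.card (torsion B n) = n := by
  have hprod : Nat.card (torsion B m) * Nat.card (torsion B n) = m * n := by
    rw [← hcard, ← Nat.card_eq_of_bijective _ (bijective_torsion_add hmn hcard), Nat.card_prod]
  have h1 : Nat.card (torsion B m) ∣ m :=
    (coprime_card_torsion hmn).dvd_of_dvd_mul_right (hprod ▸ dvd_mul_right _ _)
  have h2 : m ∣ Nat.card (torsion B m) :=
    (coprime_card_torsion (B := B) hmn.symm).symm.dvd_of_dvd_mul_right
      (hprod.symm ▸ dvd_mul_right m n)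
  have h3 := Nat.dvd_antisymm h1 h2
  rw [h3] at hprod
  exact ⟨h3, Nat.eq_of_mul_eq_mul_left hm hprod⟩

end BraceMul

/-- A subgroup whose order `m` is coprime to its index is equal to any normal subgroup of
order `m`. -/
theorem Subgroup.eq_of_card_eq_of_coprime {G : Type*} [Group G] [Finite G] {m n : ℕ}
    (hm : 0 < m) (hmn : m.Coprime n) (hG : Nat.card G = m * n) (H K : Subgroup G) [H.Normal]
    (hH : Nat.card H = m) (hK : Nat.card K = m) : K = H := by
  have hindex : H.index = n := by
    have h := H.card_mul_index
    rw [hH, hG] at h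
    exact Nat.eq_of_mul_eq_mul_left hm h
  refine Subgroup.eq_of_le_of_card_ge (fun x hx => ?_) (hH.trans hK.symm).le
  rw [← QuotientGroup.eq_one_iff, ← orderOf_eq_one_iff]
  refine Nat.eq_one_of_dvd_coprimes hmn ?_ ?_
  · refine (orderOf_map_dvd (QuotientGroup.mk' H) x).trans ?_
    exact hK ▸ Subgroup.orderOf_dvd_natCard K hx
  · exact hindex ▸ _root_.orderOf_dvd_natCard (x : G ⧸ H)

namespace BraceMul

variable {B : Type*} [AddCommGroup B] {br : BraceMul B} {m n : ℕ}

theorem lam_eq_self (hmn : m.Coprime n)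
    (hN : letI := br.mulGroup; (br.torsionSubgroup m).Normal) {a b : B}
    (ha : a ∈ torsion B m) (hb : b ∈ torsion B n) : br.lam a b = b := by
  let := br.mulGroup
  have hconj : br.circ (br.circ (br.inv b) a) b ∈ torsion B m := by
    have h := hN.conj_mem a ha (br.inv b)
    have hinv : (br.inv b)⁻¹ = b := inv_inv b
    rw [hinv] at h
    exact h
  have hcomm : br.circ a b = br.circ b (br.circ (br.circ (br.inv b) a) b) := by
    rw [← circ_assoc, ← circ_assoc, circ_inv, zero_circ]
  rw [circ_eq_add_lam, circ_eq_add_lam _ b, add_comm b] at hcomm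
  exact (eq_and_eq_of_add_eq_add hmn ha (lam_mem_torsion b hconj) (lam_mem_torsion a hb) hb
    hcomm).2

end BraceMul

theorem statement0 (m n : ℕ) (hm : 0 < m) (hn : 0 < n) (hmn : Nat.Coprime m n)
    (hnormal : ∀ (G : Type) [Group G] [Finite G], IsSolvable G → Nat.card G = m * n →
      ∃ H : Subgroup G, H.Normal ∧ Nat.card H = m)
    (B : Type) [AddCommGroup B] [Finite B] (br : BraceMul B)
    (hcard : Nat.card B = m * n)
    (hsolv : @IsSolvable B br.mulGroup) :
    ∃ B1 B2 : Set B,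
      Nat.card B1 = m ∧ Nat.card B2 = n ∧
      (0 ∈ B1 ∧ (∀ a ∈ B1, ∀ b ∈ B1, a + b ∈ B1) ∧ (∀ a ∈ B1, -a ∈ B1)) ∧
      (0 ∈ B2 ∧ (∀ a ∈ B2, ∀ b ∈ B2, a + b ∈ B2) ∧ (∀ a ∈ B2, -a ∈ B2)) ∧
      (∀ a ∈ B1, ∀ b ∈ B1, br.circ a b ∈ B1) ∧ (∀ a ∈ B1, br.inv a ∈ B1) ∧
      (∀ a ∈ B2, ∀ b ∈ B2, br.circ a b ∈ B2) ∧ (∀ a ∈ B2, br.inv a ∈ B2) ∧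
      Function.Bijective (fun x : B1 × B2 => (x.1 : B) + (x.2 : B)) ∧
      (∀ b ∈ B2, Set.BijOn (br.lam b) B1 B1 ∧
        (∀ a ∈ B1, ∀ a' ∈ B1, br.lam b (a + a') = br.lam b a + br.lam b a') ∧
        (∀ a ∈ B1, ∀ a' ∈ B1, br.lam b (br.circ a a') = br.circ (br.lam b a) (br.lam b a'))) ∧
      (∀ a ∈ B1, ∀ a' ∈ B1, ∀ b ∈ B2, ∀ b' ∈ B2,
        br.circ (a + b) (a' + b') = br.circ a (br.lam b a') + br.circ b b') := by
  obtain ⟨hcard1, hcard2⟩ := BraceMul.card_torsion hm hmn hcard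
  have hN : letI := br.mulGroup; (br.torsionSubgroup m).Normal := by
    let := br.mulGroup
    obtain ⟨H, hH, hHm⟩ := hnormal B hsolv hcard
    exact Subgroup.eq_of_card_eq_of_coprime hm hmn hcard H (br.torsionSubgroup m) hHm hcard1 ▸ hH
  have htriv : ∀ a ∈ BraceMul.torsion B m, ∀ b ∈ BraceMul.torsion B n, br.lam a b = b :=
    fun _ ha _ hb => BraceMul.lam_eq_self hmn hN ha hb
  have hadd : ∀ a ∈ BraceMul.torsion B m, ∀ b ∈ BraceMul.torsion B n,
      br.circ a b = a + b := fun a ha b hb => by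
    rw [br.circ_eq_add_lam, htriv a ha b hb]
  refine ⟨BraceMul.torsion B m, BraceMul.torsion B n, hcard1, hcard2,
    ⟨zero_mem (BraceMul.torsion B m), fun _ ha _ hb => add_mem ha hb, fun _ ha => neg_mem ha⟩,
    ⟨zero_mem (BraceMul.torsion B n), fun _ ha _ hb => add_mem ha hb, fun _ ha => neg_mem ha⟩,
    fun _ ha _ hb => BraceMul.circ_mem_torsion ha hb, fun _ ha => BraceMul.inv_mem_torsion ha,
    fun _ ha _ hb => BraceMul.circ_mem_torsion ha hb, fun _ ha => BraceMul.inv_mem_torsion ha,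
    BraceMul.bijective_torsion_add hmn hcard,
    fun b hb => ⟨br.bijOn_lam_torsion m b, fun a _ a' _ => br.lam_add b a a', ?_⟩, ?_⟩
  · have hcomm : ∀ a ∈ BraceMul.torsion B m, br.circ (br.lam b a) b = br.circ b a :=
      fun a ha => by
        rw [hadd _ (BraceMul.lam_mem_torsion b ha) b hb, br.circ_eq_add_lam b, add_comm]
    intro a ha a' ha'
    apply br.circ_right_cancel (c := b)
    rw [hcomm _ (BraceMul.circ_mem_torsion ha ha'), br.circ_assoc, hcomm a' ha',
      ← br.circ_assoc, ← br.circ_assoc, hcomm a ha]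
  · intro a ha a' ha' b hb b' hb'
    rw [← hadd a ha b hb, br.circ_eq_add_lam, br.lam_add, br.lam_circ, br.lam_circ,
      htriv a ha _ (BraceMul.lam_mem_torsion b hb'), hadd a ha b hb, br.circ_eq_add_lam a,
      br.circ_eq_add_lam b]
    abel
end

section
/- Let B be a finite left brace of cardinality m·n with gcd(m,n) = 1, and let B1 be an additive subgroup of (B,+) of order m (it is the unique such subgroup, hence characteristic in (B,+)). Then B1 is closed under the multiplication of the brace: for all a, b ∈ B1, a ∘ b ∈ B1. In particular B1 is a subbrace of B. -/
/-- The lambda map `λ_a` of a left brace, as an endomorphism of the additive group. -/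
def BraceMul.lamHom_s1 {B : Type*} [AddCommGroup B] (br : BraceMul B) (a : B) : B →+ B :=
  AddMonoidHom.mk' (br.lam a) fun b c => by
    have h := eq_sub_of_add_eq (br.compat a b c)
    simp only [BraceMul.lam, h]
    abel

/-- In an abelian group, a subgroup whose order is coprime to its index contains every
element killed by its order. -/
theorem AddSubgroup.mem_of_card_nsmul_eq_zero {B : Type*} [AddCommGroup B]
    (H : AddSubgroup B) (hH : Nat.Coprime (Nat.card H) H.index) {x : B}
    (hx : Nat.card H • x = 0) : x ∈ H := by
  rw [← QuotientAddGroup.eq_zero_iff, ← AddMonoid.addOrderOf_eq_one_iff]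
  refine Nat.eq_one_of_dvd_coprimes hH (addOrderOf_dvd_of_nsmul_eq_zero ?_)
    (_root_.addOrderOf_dvd_natCard _)
  rw [← QuotientAddGroup.mk_nsmul, hx, QuotientAddGroup.mk_zero]

theorem statement1 (m n : ℕ) (hmn : Nat.Coprime m n)
    (B : Type) [AddCommGroup B] [Finite B] (br : BraceMul B)
    (hcard : Nat.card B = m * n)
    (B1 : AddSubgroup B) (hB1 : Nat.card B1 = m) :
    ∀ a ∈ B1, ∀ b ∈ B1, br.circ a b ∈ B1 := by
  intro a ha b hb
  subst hB1
  have hindex : B1.index = n :=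
    Nat.eq_of_mul_eq_mul_left Nat.card_pos (B1.card_mul_index.trans hcard)
  have hb0 : Nat.card B1 • b = 0 := by
    exact congrArg Subtype.val (card_nsmul_eq_zero' (x := (⟨b, hb⟩ : B1)))
  have hlam : br.lamHom_s1 a b ∈ B1 :=
    B1.mem_of_card_nsmul_eq_zero (hindex ▸ hmn) (by rw [← map_nsmul, hb0, map_zero])
  have hcirc : br.circ a b = a + br.lamHom_s1 a b := (add_neg_cancel_left a _).symm
  exact hcirc ▸ B1.add_mem ha hlam
end

section
/- Let B1 and B2 be left braces and let τ : (B2,∘) → Aut(B1) be a group homomorphism into the group of brace automorphisms of B1. Then the semidirect product operations on B1 × B2, namely (a,b) + (a',b') = (a+a', b+b') and (a,b) · (a',b') = (a ∘ τ(b)(a'), b ∘ b'), make B1 × B2 a left brace: the operation · is a group operation and a∘(b+c)+a = a∘b+a∘c holds for these operations on B1 × B2. -/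
theorem statement4 (B1 B2 : Type) [AddCommGroup B1] [AddCommGroup B2]
    (br1 : BraceMul B1) (br2 : BraceMul B2)
    -- `τ : (B2,∘) → Aut(B1)` : a group homomorphism into the group of brace
    -- automorphisms of `B1`, given as a map `B2 → (B1 → B1)`
    (τ : B2 → B1 → B1)
    (hτbij : ∀ b, Function.Bijective (τ b))
    (hτadd : ∀ b x y, τ b (x + y) = τ b x + τ b y)
    (hτcirc : ∀ b x y, τ b (br1.circ x y) = br1.circ (τ b x) (τ b y))
    (hτone : τ 0 = id)
    (hτhom : ∀ b b', τ (br2.circ b b') = τ b ∘ τ b') :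
    -- the semidirect product operations on `B1 × B2` form a left brace
    let circP : B1 × B2 → B1 × B2 → B1 × B2 :=
      fun x y => (br1.circ x.1 (τ x.2 y.1), br2.circ x.2 y.2)
    (∀ x y z, circP (circP x y) z = circP x (circP y z)) ∧
    (∀ x, circP 0 x = x) ∧ (∀ x, circP x 0 = x) ∧
    (∀ x, ∃ y, circP x y = 0 ∧ circP y x = 0) ∧
    (∀ x y z, circP x (y + z) + x = circP x y + circP x z) := by
  intro circP
  have hzero : ∀ b, τ b 0 = 0 := fun b => by simpa using hτadd b 0 0
  refine ⟨fun x y z => ?_, fun x => ?_, fun x => ?_, fun x => ?_, fun x y z => ?_⟩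
  · simp [circP, hτhom, hτcirc, br1.circ_assoc, br2.circ_assoc]
  · simp [circP, hτone, br1.zero_circ, br2.zero_circ]
  · simp [circP, hzero, br1.circ_zero, br2.circ_zero]
  · refine ⟨(τ (br2.inv x.2) (br1.inv x.1), br2.inv x.2), ?_, ?_⟩
    · have hcancel : τ x.2 (τ (br2.inv x.2) (br1.inv x.1)) = br1.inv x.1 := by
        rw [← Function.comp_apply (f := τ x.2), ← hτhom, br2.circ_inv, hτone, id]
      simp [circP, hcancel, br1.circ_inv, br2.circ_inv]
    · simp [circP, ← hτcirc, br1.inv_circ, br2.inv_circ, hzero]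
  · ext
    · simpa [circP, hτadd] using br1.compat _ _ _
    · exact br2.compat _ _ _
end

section
/- Let B1 and B2 be finite left braces with gcd(|B1|,|B2|) = 1, and let σ, τ : (B2,∘) → Aut(B1) be group homomorphisms into the group of brace automorphisms of B1. Let B_σ and B_τ denote the semidirect product braces on B1 × B2, with componentwise addition and multiplication (a,b)·(a',b') = (a ∘ σ(b)(a'), b∘b') (respectively with τ in place of σ). Then every brace isomorphism h : B_σ → B_τ (bijection preserving + and ·) is of the form h(a,b) = (h1(a), h2(b)) for brace automorphisms h1 of B1 and h2 of B2 which satisfy τ(h2(b)) = h1 ∘ σ(b) ∘ h1⁻¹ for all b ∈ B2. -/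
/-- Additive homomorphisms between finite groups of coprime orders vanish. -/
theorem AddMonoidHom.apply_eq_zero_of_coprime_card {A B : Type*} [AddGroup A] [AddGroup B]
    (hcop : Nat.Coprime (Nat.card A) (Nat.card B)) (f : A →+ B) (a : A) : f a = 0 :=
  AddMonoid.addOrderOf_eq_one_iff.mp <| Nat.eq_one_of_dvd_coprimes hcop
    ((addOrderOf_map_dvd f a).trans (addOrderOf_dvd_natCard a)) (addOrderOf_dvd_natCard (f a))

/-- An additive endomorphism of a product of groups of coprime orders acts componentwise. -/
theorem AddMonoidHom.exists_prodMap_of_coprime_card {A B : Type*} [AddGroup A] [AddGroup B]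
    (hcop : Nat.Coprime (Nat.card A) (Nat.card B)) (f : A × B →+ A × B) :
    ∃ (f₁ : A →+ A) (f₂ : B →+ B), ∀ a b, f (a, b) = (f₁ a, f₂ b) := by
  refine ⟨(fst A B).comp (f.comp (inl A B)), (snd A B).comp (f.comp (inr A B)), fun a b => ?_⟩
  have hab : f (a, b) = f (a, 0) + f (0, b) := by simp [← map_add]
  have ha : (f (a, 0)).2 = 0 :=
    apply_eq_zero_of_coprime_card hcop ((snd A B).comp (f.comp (inl A B))) a
  have hb : (f (0, b)).1 = 0 :=
    apply_eq_zero_of_coprime_card hcop.symm ((fst A B).comp (f.comp (inr A B))) b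
  ext <;> simp [hab, ha, hb]

theorem statement5 (B1 B2 : Type) [AddCommGroup B1] [AddCommGroup B2]
    [Finite B1] [Finite B2]
    (br1 : BraceMul B1) (br2 : BraceMul B2)
    (hcop : Nat.Coprime (Nat.card B1) (Nat.card B2))
    -- `σ, τ : (B2,∘) → Aut(B1)` : group homomorphisms into the group of brace
    -- automorphisms of `B1`
    (σ τ : B2 → B1 → B1)
    (hσbij : ∀ b, Function.Bijective (σ b))
    (hσadd : ∀ b x y, σ b (x + y) = σ b x + σ b y)
    (hσcirc : ∀ b x y, σ b (br1.circ x y) = br1.circ (σ b x) (σ b y))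
    (hσone : σ 0 = id)
    (hσhom : ∀ b b', σ (br2.circ b b') = σ b ∘ σ b')
    (hτbij : ∀ b, Function.Bijective (τ b))
    (hτadd : ∀ b x y, τ b (x + y) = τ b x + τ b y)
    (hτcirc : ∀ b x y, τ b (br1.circ x y) = br1.circ (τ b x) (τ b y))
    (hτone : τ 0 = id)
    (hτhom : ∀ b b', τ (br2.circ b b') = τ b ∘ τ b')
    -- `h : B_σ → B_τ` is a brace isomorphism
    (h : B1 × B2 → B1 × B2)
    (hbij : Function.Bijective h)
    (haddh : ∀ x y, h (x + y) = h x + h y)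
    (hmulh : ∀ x y : B1 × B2,
      h (br1.circ x.1 (σ x.2 y.1), br2.circ x.2 y.2) =
        (br1.circ (h x).1 (τ (h x).2 (h y).1), br2.circ (h x).2 (h y).2)) :
    ∃ (h1 : B1 → B1) (h2 : B2 → B2),
      Function.Bijective h1 ∧
      (∀ a a', h1 (a + a') = h1 a + h1 a') ∧
      (∀ a a', h1 (br1.circ a a') = br1.circ (h1 a) (h1 a')) ∧
      Function.Bijective h2 ∧
      (∀ b b', h2 (b + b') = h2 b + h2 b') ∧
      (∀ b b', h2 (br2.circ b b') = br2.circ (h2 b) (h2 b')) ∧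
      (∀ a b, h (a, b) = (h1 a, h2 b)) ∧
      (∀ b a, τ (h2 b) (h1 a) = h1 (σ b a)) := by
  obtain ⟨h1, h2, hh⟩ :=
    AddMonoidHom.exists_prodMap_of_coprime_card hcop (AddMonoidHom.mk' h haddh)
  replace hh : ∀ a b, h (a, b) = (h1 a, h2 b) := hh
  have hmap : h = Prod.map h1 h2 := funext fun x => hh x.1 x.2
  obtain ⟨hbij1, hbij2⟩ := Prod.map_bijective.mp (hmap ▸ hbij)
  refine ⟨h1, h2, hbij1, map_add h1, fun a a' => ?_, hbij2, map_add h2, fun b b' => ?_, hh,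
    fun b a => ?_⟩
  · simpa [hh, hσone, hτone] using congrArg Prod.fst (hmulh (a, 0) (a', 0))
  · simpa [hh] using congrArg Prod.snd (hmulh (0, b) (0, b'))
  · simpa [hh, br1.zero_circ] using (congrArg Prod.fst (hmulh (0, b) (a, 0))).symm
end

section
/- Let p and q be prime numbers with 2 < p < q and q ≥ 5. Then every group G of order p²·q² has a unique Sylow q-subgroup; equivalently, the Sylow q-subgroup of G (of order q²) is normal in G. -/
/-- If `p < q` are odd primes and a divisor `n` of `p ^ 2` is congruent to `1` modulo `q`,
then `n = 1`. -/
theorem eq_one_of_dvd_sq_of_modEq_one {p q n : ℕ} (hp : p.Prime) (hq : q.Prime)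
    (hp2 : 2 < p) (hpq : p < q) (hn : n ∣ p ^ 2) (hmod : n ≡ 1 [MOD q]) : n = 1 := by
  obtain ⟨k, hk, rfl⟩ := (Nat.dvd_prime_pow hp).1 hn
  have hsub : q ∣ p ^ k - 1 :=
    (Nat.modEq_iff_dvd' (Nat.one_le_pow _ _ hp.pos)).1 hmod.symm
  have hlt : ¬ q ∣ p - 1 := fun h => by
    have := Nat.le_of_dvd (by lia) h
    lia
  interval_cases k
  · simp
  · exact absurd (by simpa using hsub) hlt
  · rw [← one_pow 2, Nat.sq_sub_sq] at hsub
    have hle := Nat.le_of_dvd (by lia) ((hq.dvd_mul.1 hsub).resolve_right hlt)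
    obtain ⟨a, ha⟩ := hp.odd_of_ne_two (by lia)
    obtain ⟨b, hb⟩ := hq.odd_of_ne_two (by lia)
    lia

theorem statement6 (p q : ℕ) (hp : p.Prime) (hq : q.Prime)
    (hp2 : 2 < p) (hpq : p < q) (hq5 : 5 ≤ q)
    (G : Type) [Group G] [Finite G] (hG : Nat.card G = p ^ 2 * q ^ 2) :
    ∀ Q : Sylow q G, Nat.card ↥(Q : Subgroup G) = q ^ 2 ∧ (Q : Subgroup G).Normal := by
  intro Q
  have : Fact q.Prime := ⟨hq⟩
  have hcard : Nat.card (Q : Subgroup G) = q ^ 2 := by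
    rw [Q.card_eq_multiplicity, hG,
      Nat.factorization_mul (pow_ne_zero _ hp.ne_zero) (pow_ne_zero _ hq.ne_zero)]
    simp [hp.factorization, hq.factorization, hpq.ne]
  have hindex : (Q : Subgroup G).index = p ^ 2 := by
    have h := (Q : Subgroup G).card_mul_index
    rw [hcard, hG, mul_comm (p ^ 2)] at h
    exact Nat.eq_of_mul_eq_mul_left (pow_pos hq.pos 2) h
  have hone : Nat.card (Sylow q G) = 1 :=
    eq_one_of_dvd_sq_of_modEq_one hp hq hp2 hpq (hindex ▸ Q.card_dvd_index)
      (card_sylow_modEq_one q G)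
  have : Subsingleton (Sylow q G) := (Nat.card_eq_one_iff_unique.1 hone).1
  exact ⟨hcard, Q.normal_of_subsingleton⟩
end

section
/- Let p and q be primes with q > p, q ≥ 5, p | q−1, p ∤ q+1 and p² ∤ q−1. Then the group GL(2, ℤ/qℤ) contains an element of order p, but contains no element of order p². -/
open Matrix

/-- If a power of an invertible matrix over `ZMod q` is scalar, then raising it further to the
power `q - 1` gives the identity. -/
lemma GL_pow_mul_eq_one_of_pow_eq_smul {q : ℕ} [Fact q.Prime] (A : GL (Fin 2) (ZMod q))
    {n : ℕ} {c : ZMod q} (h : (A : Matrix (Fin 2) (Fin 2) (ZMod q)) ^ n = c • 1) :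
    A ^ (n * (q - 1)) = 1 := by
  have hc : c ≠ 0 := by
    rintro rfl
    have hu : IsUnit ((A : Matrix (Fin 2) (Fin 2) (ZMod q)) ^ n) := A.isUnit.pow n
    rw [h, zero_smul] at hu
    exact not_isUnit_zero hu
  apply Units.ext
  rw [Units.val_pow_eq_pow_val, pow_mul, h, smul_pow, ZMod.pow_card_sub_one_eq_one hc, one_pow,
    one_smul, Units.val_one]

/-- For `q` an odd prime, the order of an element of `GL (Fin 2) (ZMod q)` divides
`q - 1`, `(q + 1) * (q - 1)` or `q * (q - 1)`. -/
lemma orderOf_GL_two_dvd {q : ℕ} [Fact q.Prime] (hq2 : q ≠ 2) (A : GL (Fin 2) (ZMod q)) :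
    orderOf A ∣ q - 1 ∨ orderOf A ∣ (q + 1) * (q - 1) ∨ orderOf A ∣ q * (q - 1) := by
  have hq : q.Prime := Fact.out
  have h2 : (2 : ZMod q) ≠ 0 := Ring.two_ne_zero (by rwa [ZMod.ringChar_zmod_n])
  obtain ⟨k, hk⟩ := hq.odd_of_ne_two hq2
  set M : Matrix (Fin 2) (Fin 2) (ZMod q) := A.val with hM
  set t := M.trace with ht
  set d := M.det with hd
  have hCH : M * M = t • M - d • 1 := by
    ext i j
    fin_cases i <;> fin_cases j <;>
      simp [ht, hd, Matrix.mul_apply, Fin.sum_univ_two, Matrix.trace_fin_two,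
        Matrix.det_fin_two] <;> ring
  have hE2 : (t • (1 : Matrix (Fin 2) (Fin 2) (ZMod q)) - (2 : ZMod q) • M) ^ 2
      = (t ^ 2 - 4 * d) • 1 := by
    simp only [sq, sub_mul, mul_sub, smul_mul_assoc, mul_smul_comm, one_mul, mul_one, hCH]
    module
  have hfrob : (t • (1 : Matrix (Fin 2) (Fin 2) (ZMod q)) - (2 : ZMod q) • M) ^ q
      = t • 1 - (2 : ZMod q) • M ^ q := by
    rw [sub_pow_char_of_commute]
    · rw [smul_pow, smul_pow, one_pow, ZMod.pow_card, ZMod.pow_card]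
    · exact (Commute.one_left _).smul_left _
  have hpow : (t • (1 : Matrix (Fin 2) (Fin 2) (ZMod q)) - (2 : ZMod q) • M) ^ q
      = ((t ^ 2 - 4 * d) ^ k) • (t • 1 - (2 : ZMod q) • M) := by
    refine (congrArg (_ ^ ·) hk).trans ?_
    rw [pow_succ, pow_mul, hE2, smul_pow, one_pow, smul_mul_assoc, one_mul]
  rw [hfrob] at hpow
  have hk2 : q / 2 = k := by omega
  have cancel : ∀ {X Y : Matrix (Fin 2) (Fin 2) (ZMod q)},
      (2 : ZMod q) • X = (2 : ZMod q) • Y → X = Y := fun h => smul_right_injective _ h2 h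
  by_cases hδ : t ^ 2 - 4 * d = 0
  · have hk0 : k ≠ 0 := by have := hq.two_le; omega
    rw [hδ, zero_pow hk0, zero_smul, sub_eq_zero] at hpow
    refine Or.inr (Or.inr (orderOf_dvd_of_pow_eq_one
      (GL_pow_mul_eq_one_of_pow_eq_smul A (c := 2⁻¹ * t) (cancel ?_))))
    rw [← hM, ← hpow, smul_smul, mul_inv_cancel_left₀ h2]
  rcases ZMod.pow_div_two_eq_neg_one_or_one q hδ with hε | hε <;> rw [hk2] at hε <;>
    rw [hε] at hpow
  · have hMq : M ^ q = M := cancel (by rwa [one_smul, sub_right_inj] at hpow)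
    refine Or.inl (orderOf_dvd_of_pow_eq_one (mul_right_cancel (b := A) ?_))
    rw [← pow_succ, Nat.sub_add_cancel hq.one_le, one_mul]
    exact Units.ext (by rw [Units.val_pow_eq_pow_val, ← hM, hMq])
  · have hMq : M ^ q = t • 1 - M := cancel (by linear_combination (norm := module) -hpow)
    refine Or.inr (Or.inl (orderOf_dvd_of_pow_eq_one
      (GL_pow_mul_eq_one_of_pow_eq_smul A (c := d) ?_)))
    rw [← hM, pow_succ, hMq, sub_mul, hCH, smul_mul_assoc, one_mul]
    abel

theorem statement8 (p q : ℕ) (hp : p.Prime) (hq : q.Prime)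
    (hpq : p < q) (hq5 : 5 ≤ q)
    (h1 : p ∣ q - 1) (h2 : ¬ p ∣ q + 1) (h3 : ¬ p ^ 2 ∣ q - 1) :
    (∃ A : GL (Fin 2) (ZMod q), orderOf A = p) ∧
    (∀ A : GL (Fin 2) (ZMod q), orderOf A ≠ p ^ 2) := by
  have := Fact.mk hp
  have := Fact.mk hq
  refine ⟨?_, fun A hA => ?_⟩
  · obtain ⟨u, hu⟩ := exists_prime_orderOf_dvd_card' (G := (ZMod q)ˣ) p
      (by rwa [Nat.card_eq_fintype_card, ZMod.card_units])
    have hinj : Function.Injective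
        (Units.map (Matrix.scalar (Fin 2) : ZMod q →+* _).toMonoidHom) :=
      Units.map_injective fun _ _ h => Matrix.scalar_inj.1 h
    exact ⟨_, (orderOf_injective _ hinj u).trans hu⟩
  · have hcop : (p ^ 2).Coprime (q + 1) := ((hp.coprime_iff_not_dvd).2 h2).pow_left 2
    have hcop' : (p ^ 2).Coprime q := ((Nat.coprime_primes hp hq).2 hpq.ne).pow_left 2
    rcases orderOf_GL_two_dvd (by omega) A with h | h | h <;> rw [hA] at h
    · exact h3 h
    · exact h3 (hcop.dvd_of_dvd_mul_left h)
    · exact h3 (hcop'.dvd_of_dvd_mul_left h)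
end

section
/- Let p and q be primes with q > p, q ≥ 5, p | q−1, p ∤ q+1 and p² ∤ q−1. Then the number of subgroups of order p of GL(2, ℤ/qℤ), counted up to conjugation in GL(2, ℤ/qℤ), is exactly (p+3)/2. -/
open Matrix

namespace GLTwo

variable {F : Type*} [Field F]

/-- The embedding of pairs of units of a field as diagonal matrices in `GL(2, F)`. -/
def diag : Fˣ × Fˣ →* GL (Fin 2) F where
  toFun u := ⟨diagonal ![(u.1 : F), u.2], diagonal ![((u.1⁻¹ : Fˣ) : F), ((u.2⁻¹ : Fˣ) : F)],
    by ext i j; fin_cases i <;> fin_cases j <;> simp,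
    by ext i j; fin_cases i <;> fin_cases j <;> simp⟩
  map_one' := by ext i j; fin_cases i <;> fin_cases j <;> simp
  map_mul' u v := by ext i j; fin_cases i <;> fin_cases j <;> simp

theorem coe_diag (u : Fˣ × Fˣ) :
    (diag u : Matrix (Fin 2) (Fin 2) F) = diagonal ![(u.1 : F), u.2] := rfl

theorem diag_injective : Function.Injective (diag (F := F)) := by
  intro u v h
  have hmat : diagonal ![(u.1 : F), u.2] = diagonal ![(v.1 : F), v.2] := congrArg Units.val h
  have hvec := diagonal_injective hmat
  refine Prod.ext (Units.ext ?_) (Units.ext ?_)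
  · exact congrFun hvec 0
  · exact congrFun hvec 1

/-- Conjugate diagonal matrices have the same entries up to order. -/
theorem eq_or_eq_swap_of_conj_diag {g : GL (Fin 2) F} {u v : Fˣ × Fˣ}
    (h : g * diag u * g⁻¹ = diag v) : u = v ∨ u = v.swap := by
  have hm : (g : Matrix (Fin 2) (Fin 2) F) * diag u * (g⁻¹ : GL (Fin 2) F) = diag v :=
    congrArg Units.val h
  have ht := congrArg Matrix.trace hm
  have hd := congrArg Matrix.det hm
  rw [Matrix.trace_units_conj] at ht
  rw [Matrix.det_units_conj] at hd
  simp only [coe_diag, trace_fin_two, det_diagonal, Fin.prod_univ_two, diagonal_apply_eq,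
    cons_val_zero, cons_val_one] at ht hd
  have key : ((u.1 : F) - v.1) * (u.1 - v.2) = 0 := by linear_combination (u.1 : F) * ht - hd
  rcases mul_eq_zero.mp key with h | h
  · left
    have h := sub_eq_zero.mp h
    exact Prod.ext (Units.ext h) (Units.ext (by linear_combination ht - h))
  · right
    have h := sub_eq_zero.mp h
    exact Prod.ext (Units.ext h) (Units.ext (by
      simp only [Prod.snd_swap]; linear_combination ht - h))

theorem exists_conj_diag_eq_diag_swap :
    ∃ g : GL (Fin 2) F, ∀ u : Fˣ × Fˣ, g * diag u * g⁻¹ = diag u.swap := by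
  refine ⟨⟨!![0, 1; 1, 0], !![0, 1; 1, 0], by simp [one_fin_two], by simp [one_fin_two]⟩,
    fun u => ?_⟩
  rw [mul_inv_eq_iff_eq_mul]
  ext i j
  fin_cases i <;> fin_cases j <;> simp [coe_diag, Matrix.mul_apply]

theorem card_zpowers_diag {p : ℕ} {ζ : Fˣ} (hζ : orderOf ζ = p) (n : ℕ) :
    Nat.card (Subgroup.zpowers (diag (ζ, ζ ^ n))) = p := by
  rw [Nat.card_zpowers, orderOf_injective _ diag_injective, Prod.orderOf_mk, hζ]
  exact Nat.lcm_eq_left (hζ ▸ orderOf_pow_dvd n)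

/-- The number of orbits of an involution, counted with the number of its fixed points. -/
theorem card_mul_two_of_involutive {α β : Type*} [Fintype α] [DecidableEq α] {σ : α → α}
    (hσ : Function.Involutive σ) {π : α → β} (hs : Function.Surjective π)
    (hπ : ∀ a b, π a = π b ↔ b = a ∨ b = σ a) :
    Nat.card β * 2 = Fintype.card α + (Finset.univ.filter fun a => σ a = a).card := by
  classical
  have : Fintype β := Fintype.ofSurjective π hs
  have hfib : ∀ c : β, ∑ a with π a = c, (1 + if σ a = a then 1 else 0) = 2 := by
    intro c
    obtain ⟨a, rfl⟩ := hs c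
    have : (Finset.univ.filter fun b => π b = π a) = {a, σ a} := by
      ext b
      rw [Finset.mem_filter_univ, eq_comm, hπ]
      simp
    rw [this]
    by_cases h : σ a = a
    · simp [h]
    · rw [Finset.sum_pair (Ne.symm h), hσ a]
      simp [h, Ne.symm h]
  have hsum := Finset.sum_fiberwise (Finset.univ : Finset α) π
    (fun a => 1 + if σ a = a then 1 else 0)
  simp only [hfib, Finset.sum_add_distrib, Finset.sum_boole] at hsum
  simpa [Nat.card_eq_fintype_card] using hsum

theorem card_inv_eq_self {p : ℕ} [Fact p.Prime] (hp : p ≠ 2) :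
    (Finset.univ.filter fun a : ZMod p => a⁻¹ = a).card = 3 := by
  have : Fact (2 < p) := ⟨by have := (Fact.out : p.Prime).two_le; omega⟩
  have h : (Finset.univ.filter fun a : ZMod p => a⁻¹ = a) = {0, 1, -1} := by
    ext a
    simp only [Finset.mem_filter_univ, inv_eq_self₀, Finset.mem_insert, Finset.mem_singleton]
    tauto
  rw [h, Finset.card_eq_three]
  exact ⟨0, 1, -1, by simp, by simp, (ZMod.neg_one_ne_one).symm, rfl⟩

theorem factorization_card {p q : ℕ} (hp : p.Prime) (hq : q.Prime) (hpq : p < q)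
    (h1 : p ∣ q - 1) (h2 : ¬ p ∣ q + 1) (h3 : ¬ p ^ 2 ∣ q - 1) [Fact q.Prime] :
    (Nat.card (GL (Fin 2) (ZMod q))).factorization p = 2 := by
  obtain ⟨m, rfl⟩ : ∃ m, q = m + 1 := ⟨q - 1, by have := hq.pos; omega⟩
  simp only [Nat.add_sub_cancel] at h1 h3
  have hm : m ≠ 0 := by rintro rfl; simp at h3
  have hcard : Nat.card (GL (Fin 2) (ZMod (m + 1))) = (m * m) * ((m + 1 + 1) * (m + 1)) := by
    rw [card_GL_field, Fin.prod_univ_two]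
    simp only [ZMod.card, Fin.val_zero, Fin.val_one, pow_zero, pow_one]
    have e1 : (m + 1) ^ 2 - 1 = m * (m + 1 + 1) := by
      rw [Nat.sub_eq_iff_eq_add (Nat.one_le_pow _ _ (by omega))]; ring
    have e2 : (m + 1) ^ 2 - (m + 1) = m * (m + 1) := by
      rw [Nat.sub_eq_iff_eq_add (Nat.le_self_pow (by norm_num) _)]; ring
    rw [e1, e2]; ring
  have f1 : m.factorization p = 1 := by
    have ha := (hp.pow_dvd_iff_le_factorization (k := 1) hm).mp (by simpa using h1)
    have hb := mt (hp.pow_dvd_iff_le_factorization (k := 2) hm).mpr h3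
    omega
  have f2 : ¬ p ∣ m + 1 := fun h => by
    rcases (Nat.dvd_prime hq).mp h with h | h
    · exact hp.one_lt.ne' h
    · omega
  rw [hcard, Nat.factorization_mul (by positivity) (by positivity),
    Nat.factorization_mul hm hm, Nat.factorization_mul (by positivity) (by positivity)]
  simp [f1, Nat.factorization_eq_zero_of_not_dvd h2, Nat.factorization_eq_zero_of_not_dvd f2]

/-- Every `p`-element of `GL(2, F)` is diagonalizable over the `p`-th roots of unity, provided
`p ^ 2` is the exact power of `p` dividing the order of `GL(2, F)`. -/
theorem exists_conj_eq_diag [Finite F] {p : ℕ} [Fact p.Prime] {ζ : Fˣ} (hζ : orderOf ζ = p)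
    (hcard : (Nat.card (GL (Fin 2) F)).factorization p = 2) {A : GL (Fin 2) F}
    (hA : orderOf A = p) :
    ∃ (g : GL (Fin 2) F) (i j : ℕ), g * A * g⁻¹ = diag (ζ ^ i, ζ ^ j) := by
  let T : Subgroup (GL (Fin 2) F) :=
    ((Subgroup.zpowers ζ).prod (Subgroup.zpowers ζ)).map diag
  have hT : Nat.card T = p ^ (Nat.card (GL (Fin 2) F)).factorization p := by
    rw [hcard, Subgroup.card_map_of_injective diag_injective,
      Nat.card_congr (Subgroup.prodEquiv _ _).toEquiv, Nat.card_prod, Nat.card_zpowers, hζ, sq]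
  let P : Sylow p (GL (Fin 2) F) := Sylow.ofCard T hT
  have hpA : IsPGroup p (Subgroup.zpowers A) :=
    IsPGroup.of_card (n := 1) (by rw [Nat.card_zpowers, hA, pow_one])
  obtain ⟨Q, hQ⟩ := hpA.exists_le_sylow
  obtain ⟨g, hg⟩ := MulAction.exists_smul_eq (GL (Fin 2) F) Q P
  have hmem : g * A * g⁻¹ ∈ T := by
    have : g * A * g⁻¹ ∈ g • Q := by
      rw [Sylow.smul_def]
      exact Subgroup.mem_map_of_mem _ (hQ (Subgroup.mem_zpowers A))
    rw [hg] at this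
    exact this
  obtain ⟨⟨u, v⟩, ⟨hu, hv⟩, huv⟩ := hmem
  obtain ⟨i, rfl⟩ := mem_powers_iff_mem_zpowers.mpr hu
  obtain ⟨j, rfl⟩ := mem_powers_iff_mem_zpowers.mpr hv
  exact ⟨g, i, j, huv.symm⟩

theorem pow_eq_pow_iff_cast {p : ℕ} {ζ : Fˣ} (hζ : orderOf ζ = p) (m n : ℕ) :
    ζ ^ m = ζ ^ n ↔ (m : ZMod p) = n := by
  rw [pow_eq_pow_iff_modEq, hζ, ZMod.natCast_eq_natCast_iff]

/-- Conjugacy of subgroups of order `p`. -/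
abbrev ConjRel (G : Type*) [Group G] (p : ℕ) (H K : {H : Subgroup G // Nat.card H = p}) : Prop :=
  ∃ g : G, Subgroup.map (MulAut.conj g).toMonoidHom H.1 = K.1

theorem conjRel_equivalence (G : Type*) [Group G] (p : ℕ) : Equivalence (ConjRel G p) where
  refl H := ⟨1, by ext; simp⟩
  symm := by
    rintro H K ⟨g, h⟩
    refine ⟨g⁻¹, ?_⟩
    rw [← h, Subgroup.map_map]
    ext; simp [mul_assoc]
  trans := by
    rintro H K L ⟨g, h⟩ ⟨k, hk⟩
    refine ⟨k * g, ?_⟩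
    rw [← hk, ← h, Subgroup.map_map]
    congr 1
    ext; simp

theorem conjRel_of_mem {G : Type*} [Group G] [Finite G] {p : ℕ} {A B g : G}
    (hA : Nat.card (Subgroup.zpowers A) = p) (hB : Nat.card (Subgroup.zpowers B) = p)
    (h : g * A * g⁻¹ ∈ Subgroup.zpowers B) :
    ConjRel G p ⟨Subgroup.zpowers A, hA⟩ ⟨Subgroup.zpowers B, hB⟩ := by
  refine ⟨g, ?_⟩
  apply Subgroup.eq_of_le_of_card_ge
  · rw [MonoidHom.map_zpowers, Subgroup.zpowers_le]
    exact h
  · rw [hB, Subgroup.card_map_of_injective (MulAut.conj g).injective, hA]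

/-- The subgroup generated by `diag (ζ, ζ ^ k)`. -/
def diagSubgroup {p : ℕ} {ζ : Fˣ} (hζ : orderOf ζ = p) (k : ZMod p) :
    {H : Subgroup (GL (Fin 2) F) // Nat.card H = p} :=
  ⟨Subgroup.zpowers (diag (ζ, ζ ^ k.val)), card_zpowers_diag hζ _⟩

theorem conjRel_diagSubgroup_iff [Finite F] {p : ℕ} [Fact p.Prime] {ζ : Fˣ}
    (hζ : orderOf ζ = p) (a b : ZMod p) :
    ConjRel (GL (Fin 2) F) p (diagSubgroup hζ a) (diagSubgroup hζ b) ↔ b = a ∨ b = a⁻¹ := by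
  constructor
  · rintro ⟨g, h⟩
    have hmem : g * diag (ζ, ζ ^ a.val) * g⁻¹ ∈ Subgroup.zpowers (diag (ζ, ζ ^ b.val)) := by
      change _ = Subgroup.zpowers (diag (ζ, ζ ^ b.val)) at h
      rw [← h]
      exact Subgroup.mem_map_of_mem _ (Subgroup.mem_zpowers _)
    obtain ⟨m, hm⟩ := mem_powers_iff_mem_zpowers.mpr hmem
    replace hm : g * diag (ζ, ζ ^ a.val) * g⁻¹ = diag (ζ ^ m, ζ ^ (b.val * m)) := by
      rw [← hm]
      simp [← map_pow, pow_mul]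
    have h1 (n : ℕ) : ζ = ζ ^ n ↔ (1 : ZMod p) = n := by
      simpa using pow_eq_pow_iff_cast hζ 1 n
    rcases eq_or_eq_swap_of_conj_diag hm with h | h
    · simp only [Prod.mk.injEq, h1, pow_eq_pow_iff_cast hζ] at h
      push_cast [ZMod.natCast_zmod_val] at h
      left
      rw [h.2, ← h.1, mul_one]
    · simp only [Prod.swap_prod_mk, Prod.mk.injEq, h1, pow_eq_pow_iff_cast hζ] at h
      push_cast [ZMod.natCast_zmod_val] at h
      right
      rw [h.2]
      exact eq_inv_of_mul_eq_one_left h.1.symm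
  · rintro (rfl | rfl)
    · exact (conjRel_equivalence _ _).refl _
    · rcases eq_or_ne a 0 with rfl | ha
      · rw [_root_.inv_zero]
        exact (conjRel_equivalence _ _).refl _
      obtain ⟨g, hg⟩ := exists_conj_diag_eq_diag_swap (F := F)
      refine conjRel_of_mem (g := g) _ _ ?_
      rw [hg]
      refine Subgroup.mem_zpowers_iff.mpr ⟨a.val, ?_⟩
      rw [zpow_natCast, ← map_pow, Prod.pow_mk, ← pow_mul, Prod.swap_prod_mk]
      congr 2
      nth_rewrite 2 [← pow_one ζ]
      rw [pow_eq_pow_iff_cast hζ]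
      push_cast [ZMod.natCast_zmod_val]
      exact inv_mul_cancel₀ ha

theorem exists_conjRel_diagSubgroup [Finite F] {p : ℕ} [Fact p.Prime] {ζ : Fˣ}
    (hζ : orderOf ζ = p) (hcard : (Nat.card (GL (Fin 2) F)).factorization p = 2)
    (H : {H : Subgroup (GL (Fin 2) F) // Nat.card H = p}) :
    ∃ k : ZMod p, ConjRel (GL (Fin 2) F) p H (diagSubgroup hζ k) := by
  obtain ⟨H, hH⟩ := H
  have : IsCyclic H := isCyclic_of_prime_card hH
  obtain ⟨A, rfl⟩ := (Subgroup.isCyclic_iff_exists_zpowers_eq_top H).mp this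
  have hA : orderOf A = p := by rw [← Nat.card_zpowers, hH]
  obtain ⟨g, i, j, hg⟩ := exists_conj_eq_diag hζ hcard hA
  have main (g : GL (Fin 2) F) (i j : ℕ) (hg : g * A * g⁻¹ = diag (ζ ^ i, ζ ^ j))
      (hi : (i : ZMod p) ≠ 0) :
      ∃ k : ZMod p, ConjRel (GL (Fin 2) F) p ⟨Subgroup.zpowers A, hH⟩ (diagSubgroup hζ k) := by
    refine ⟨j / i, conjRel_of_mem (g := g) _ _ ?_⟩
    refine Subgroup.mem_zpowers_iff.mpr ⟨i, ?_⟩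
    rw [hg, zpow_natCast, ← map_pow, Prod.pow_mk, ← pow_mul]
    congr 2
    rw [pow_eq_pow_iff_cast hζ]
    push_cast [ZMod.natCast_zmod_val]
    exact div_mul_cancel₀ _ hi
  by_cases hi : (i : ZMod p) = 0
  · obtain ⟨s, hs⟩ := exists_conj_diag_eq_diag_swap (F := F)
    refine main (s * g) j i ?_ fun hj => ?_
    · rw [← Prod.swap_prod_mk, ← hs, ← hg]
      group
    · have e (n : ℕ) (hn : (n : ZMod p) = 0) : ζ ^ n = 1 := by
        rw [← pow_zero ζ, pow_eq_pow_iff_cast hζ, hn, Nat.cast_zero]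
      have hone : g * A * g⁻¹ = 1 := by rw [hg, e i hi, e j hj]; exact map_one diag
      have hA1 : A = 1 := conj_eq_one_iff.mp hone
      rw [hA1, orderOf_one] at hA
      exact (Fact.out : p.Prime).one_lt.ne hA
  · exact main g i j hg hi

end GLTwo

theorem statement9 (p q : ℕ) (hp : p.Prime) (hq : q.Prime)
    (hpq : p < q) (hq5 : 5 ≤ q)
    (h1 : p ∣ q - 1) (h2 : ¬ p ∣ q + 1) (h3 : ¬ p ^ 2 ∣ q - 1) :
    -- the number of conjugacy classes of order-`p` subgroups of `GL(2, ℤ/qℤ)`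
    -- equals `(p+3)/2`
    Nat.card (Quot (fun H K : {H : Subgroup (GL (Fin 2) (ZMod q)) // Nat.card H = p} =>
      ∃ g : GL (Fin 2) (ZMod q),
        Subgroup.map (MulAut.conj g).toMonoidHom H.1 = K.1)) * 2 = p + 3 := by
  have : Fact p.Prime := ⟨hp⟩
  have : Fact q.Prime := ⟨hq⟩
  have hp2 : p ≠ 2 := by
    rintro rfl
    exact h2 (by omega)
  obtain ⟨ζ, hζ⟩ : ∃ ζ : (ZMod q)ˣ, orderOf ζ = p :=
    exists_prime_orderOf_dvd_card p (by rwa [ZMod.card_units])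
  have hcard := GLTwo.factorization_card hp hq hpq h1 h2 h3
  have key := GLTwo.card_mul_two_of_involutive (α := ZMod p) (σ := fun a => a⁻¹) inv_inv
    (π := fun k => Quot.mk (GLTwo.ConjRel (GL (Fin 2) (ZMod q)) p) (GLTwo.diagSubgroup hζ k))
    (by
      rintro ⟨H⟩
      obtain ⟨k, hk⟩ := GLTwo.exists_conjRel_diagSubgroup hζ hcard H
      exact ⟨k, (Quot.sound hk).symm⟩)
    (fun a b => ((GLTwo.conjRel_equivalence _ _).quot_mk_eq_iff _ _).trans
      (GLTwo.conjRel_diagSubgroup_iff hζ a b))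
  rwa [GLTwo.card_inv_eq_self hp2, ZMod.card] at key
end

section
/- Let p and q be primes with q > p, q ≥ 5, p | q−1, p ∤ q+1 and p² ∤ q−1, and let λ be a fixed generator of the unique subgroup of order p of (ℤ/qℤ)*. Then every subgroup of order p of GL(2, ℤ/qℤ) is conjugate in GL(2, ℤ/qℤ) to a subgroup generated by a diagonal matrix diag(λ^i, λ^j) for some integers i, j; in particular every element of order p of GL(2, ℤ/qℤ) is conjugate to a diagonal matrix. -/
open Matrix

/-- The diagonal matrix `diag(a, b)` with unit entries, as an element of `GL(2, R)`. -/
def diagGL {R : Type*} [CommRing R] (a b : Rˣ) : GL (Fin 2) R where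
  val := Matrix.diagonal ![(a : R), (b : R)]
  inv := Matrix.diagonal ![((a⁻¹ : Rˣ) : R), ((b⁻¹ : Rˣ) : R)]
  val_inv := by
    rw [Matrix.diagonal_mul_diagonal]
    have h : (fun i => ![(a : R), (b : R)] i * ![((a⁻¹ : Rˣ) : R), ((b⁻¹ : Rˣ) : R)] i)
        = (1 : Fin 2 → R) := by
      funext i; fin_cases i <;> simp
    rw [h]; exact Matrix.diagonal_one
  inv_val := by
    rw [Matrix.diagonal_mul_diagonal]
    have h : (fun i => ![((a⁻¹ : Rˣ) : R), ((b⁻¹ : Rˣ) : R)] i * ![(a : R), (b : R)] i)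
        = (1 : Fin 2 → R) := by
      funext i; fin_cases i <;> simp
    rw [h]; exact Matrix.diagonal_one

/-- If `f ^ n = 1` and `K` contains a primitive `n`-th root of unity `ζ`, every vector lies in
the span of the eigenvectors of `f` whose eigenvalues are powers of `ζ`. -/
theorem mem_span_eigenvectors_of_pow_eq_one {K V : Type*} [Field K] [AddCommGroup V] [Module K V]
    {n : ℕ} [NeZero n] {ζ : Kˣ} (hζ : IsPrimitiveRoot ζ n) (f : Module.End K V) (hf : f ^ n = 1)
    (v : V) : v ∈ Submodule.span K {w : V | ∃ i : ℤ, f w = ((ζ ^ i : Kˣ) : K) • w} := by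
  have hζK : IsPrimitiveRoot (ζ : K) n := IsPrimitiveRoot.coe_units_iff.mpr hζ
  have hn : (n : K) ≠ 0 := (hζK.neZero').out
  let w : ℕ → V := fun i ↦ ∑ k ∈ Finset.range n, (((ζ : K) ^ i) ^ k) • (f ^ k) v
  have hw (i : ℕ) : f (w i) = ((ζ ^ (-(i : ℤ)) : Kˣ) : K) • w i := by
    have hcyc : ((ζ : K) ^ i) • f (w i) = w i := by
      have h1 : ((ζ : K) ^ i) • f (w i) =
          ∑ k ∈ Finset.range n, (((ζ : K) ^ i) ^ (k + 1)) • (f ^ (k + 1)) v := by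
        simp only [w, map_sum, map_smul, Finset.smul_sum, smul_smul]
        refine Finset.sum_congr rfl fun k _ ↦ ?_
        rw [pow_succ' f, pow_succ' ((ζ : K) ^ i)]
        rfl
      have h2 := (Finset.sum_range_succ' (fun k ↦ (((ζ : K) ^ i) ^ k) • (f ^ k) v) n).symm.trans
        (Finset.sum_range_succ _ n)
      rw [hf, pow_right_comm (ζ : K) i n, hζK.pow_eq_one, one_pow, pow_zero, pow_zero,
        add_left_inj] at h2
      rw [h1, h2]
    conv_rhs => rw [← hcyc]
    rw [smul_smul, ← Units.val_pow_eq_pow_val, ← Units.val_mul]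
    simp
  have hsum : ∑ i ∈ Finset.range n, w i = (n : K) • v := by
    have hinner (k : ℕ) (hk : k ∈ Finset.range n) (hk0 : k ≠ 0) :
        ∑ i ∈ Finset.range n, ((ζ : K) ^ i) ^ k = 0 := by
      have hne : (ζ : K) ^ k - 1 ≠ 0 :=
        sub_ne_zero.mpr (hζK.pow_ne_one_of_pos_of_lt hk0 (Finset.mem_range.mp hk))
      have hgeom := geom_sum_mul ((ζ : K) ^ k) n
      rw [← pow_mul, mul_comm k n, pow_mul, hζK.pow_eq_one, one_pow, sub_self] at hgeom
      simpa only [← pow_mul, mul_comm k] using (mul_eq_zero.mp hgeom).resolve_right hne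
    simp only [w]
    rw [Finset.sum_comm]
    simp only [← Finset.sum_smul]
    rw [Finset.sum_eq_single_of_mem 0 (Finset.mem_range.mpr (NeZero.pos n))]
    · simp
    · intro k hk hk0
      rw [hinner k hk hk0, zero_smul]
  have hv : v = (n : K)⁻¹ • ∑ i ∈ Finset.range n, w i := by
    rw [hsum, smul_smul, inv_mul_cancel₀ hn, one_smul]
  rw [hv]
  exact Submodule.smul_mem _ _ (Submodule.sum_mem _ fun i _ ↦ Submodule.subset_span ⟨_, hw i⟩)

/-- An element of `GL(2, K)` killed by `n` is conjugate to a diagonal matrix of powers of `ζ`, for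
any primitive `n`-th root of unity `ζ` in `K`. -/
theorem exists_conj_eq_diagGL_of_pow_eq_one {K : Type*} [Field K] {n : ℕ} [NeZero n] {ζ : Kˣ}
    (hζ : IsPrimitiveRoot ζ n) (A : GL (Fin 2) K) (hA : A ^ n = 1) :
    ∃ (i j : ℤ) (g : GL (Fin 2) K), g * A * g⁻¹ = diagGL (ζ ^ i) (ζ ^ j) := by
  let f : Module.End K (Fin 2 → K) := Matrix.toLinAlgEquiv' (A : Matrix (Fin 2) (Fin 2) K)
  have hf : f ^ n = 1 := by
    rw [← map_pow, ← Units.val_pow_eq_pow_val, hA, Units.val_one, map_one]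
  let B := Module.Basis.ofSpan (K := K) (V := Fin 2 → K)
    (s := {w | ∃ i : ℤ, f w = ((ζ ^ i : Kˣ) : K) • w})
    (fun v _ ↦ mem_span_eigenvectors_of_pow_eq_one hζ f hf v)
  let b := B.reindex (B.indexEquiv (Pi.basisFun K (Fin 2)))
  have hb (k : Fin 2) : ∃ i : ℤ, A.val *ᵥ b k = ((ζ ^ i : Kˣ) : K) • b k := by
    have h := Module.Basis.ofSpan_subset (K := K) (V := Fin 2 → K)
      (s := {w | ∃ i : ℤ, f w = ((ζ ^ i : Kˣ) : K) • w})
      (fun v _ ↦ mem_span_eigenvectors_of_pow_eq_one hζ f hf v)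
    refine h ?_
    simp [b, B]
  choose e he using hb
  let P : GL (Fin 2) K :=
    ⟨(Pi.basisFun K (Fin 2)).toMatrix b, b.toMatrix (Pi.basisFun K (Fin 2)),
      Module.Basis.toMatrix_mul_toMatrix_flip _ _, Module.Basis.toMatrix_mul_toMatrix_flip _ _⟩
  refine ⟨e 0, e 1, P⁻¹, ?_⟩
  have hAP : A * P = P * diagGL (ζ ^ e 0) (ζ ^ e 1) := by
    ext r k
    have h := congrFun (he k) r
    have hP (r k : Fin 2) : (P : Matrix (Fin 2) (Fin 2) K) r k = b k r := by
      simp [P, Module.Basis.toMatrix_apply]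
    have hD : ((diagGL (ζ ^ e 0) (ζ ^ e 1) : GL (Fin 2) K) : Matrix (Fin 2) (Fin 2) K) =
        Matrix.diagonal fun k ↦ ((ζ ^ e k : Kˣ) : K) := by
      ext r k
      fin_cases r <;> fin_cases k <;> simp [diagGL]
    rw [Units.val_mul, Units.val_mul, hD, Matrix.mul_diagonal, hP, mul_comm, Matrix.mul_apply]
    simp only [hP]
    exact h
  rw [inv_inv, mul_assoc, hAP, inv_mul_cancel_left]

theorem statement10 (p q : ℕ) (hp : p.Prime) (hq : q.Prime)
    (hpq : p < q) (hq5 : 5 ≤ q)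
    (h1 : p ∣ q - 1) (h2 : ¬ p ∣ q + 1) (h3 : ¬ p ^ 2 ∣ q - 1)
    -- `lam` is a generator of the unique subgroup of order `p` of `(ℤ/qℤ)*`,
    -- i.e. an element of order `p`
    (lam : (ZMod q)ˣ) (hlam : orderOf lam = p) :
    (∀ H : Subgroup (GL (Fin 2) (ZMod q)), Nat.card H = p →
      ∃ (i j : ℤ) (g : GL (Fin 2) (ZMod q)),
        Subgroup.map (MulAut.conj g).toMonoidHom H =
          Subgroup.zpowers (diagGL (lam ^ i) (lam ^ j))) ∧
    (∀ A : GL (Fin 2) (ZMod q), orderOf A = p →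
      ∃ (g : GL (Fin 2) (ZMod q)) (a b : (ZMod q)ˣ), g * A * g⁻¹ = diagGL a b) := by
  have : Fact p.Prime := ⟨hp⟩
  have : Fact q.Prime := ⟨hq⟩
  have : NeZero p := ⟨hp.ne_zero⟩
  have hζ : IsPrimitiveRoot lam p := hlam ▸ IsPrimitiveRoot.orderOf lam
  constructor
  · intro H hH
    have : IsCyclic H := isCyclic_of_prime_card hH
    obtain ⟨A, rfl⟩ := (Subgroup.isCyclic_iff_exists_zpowers_eq_top H).mp this
    rw [Nat.card_zpowers] at hH
    obtain ⟨i, j, g, hg⟩ := exists_conj_eq_diagGL_of_pow_eq_one hζ A (hH ▸ pow_orderOf_eq_one A)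
    refine ⟨i, j, g, ?_⟩
    rw [MonoidHom.map_zpowers, ← hg]
    rfl
  · intro A hA
    obtain ⟨i, j, g, hg⟩ := exists_conj_eq_diagGL_of_pow_eq_one hζ A (hA ▸ pow_orderOf_eq_one A)
    exact ⟨g, _, _, hg⟩
end

section
/- Let p and q be primes with q > p, q ≥ 5, p | q−1, p ∤ q+1 and p² ∤ q−1, and let λ be a fixed generator of the unique subgroup of order p of (ℤ/qℤ)*. For k, ℓ ∈ ℤ/pℤ, the subgroups of GL(2, ℤ/qℤ) generated by diag(λ, λ^k) and by diag(λ, λ^ℓ) are conjugate in GL(2, ℤ/qℤ) if and only if ℓ = k or k·ℓ = 1 in ℤ/pℤ. -/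
open Matrix

/-- `diagGL` as a group homomorphism from pairs of units. -/
def diagGLHom (R : Type*) [CommRing R] : Rˣ × Rˣ →* GL (Fin 2) R :=
  MonoidHom.mk' (fun x => diagGL x.1 x.2) fun x y => by
    ext i j
    fin_cases i <;> fin_cases j <;> simp [diagGL]

theorem diagGL_zpow {R : Type*} [CommRing R] (a b : Rˣ) (n : ℤ) :
    diagGL a b ^ n = diagGL (a ^ n) (b ^ n) :=
  (map_zpow (diagGLHom R) (a, b) n).symm

/-- Two diagonal matrices over a field that are conjugate have the same diagonal entries
up to order. -/
theorem eq_or_swap_of_conj_diagGL {F : Type*} [Field F] {a b c d : Fˣ} {g : GL (Fin 2) F}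
    (h : g * diagGL a b * g⁻¹ = diagGL c d) : (a = c ∧ b = d) ∨ (a = d ∧ b = c) := by
  have hmul : (g : Matrix (Fin 2) (Fin 2) F) * diagonal ![(a : F), (b : F)] =
      diagonal ![(c : F), (d : F)] * (g : Matrix (Fin 2) (Fin 2) F) :=
    congrArg Units.val (mul_inv_eq_iff_eq_mul.mp h)
  have entry (i j : Fin 2) : (g : Matrix (Fin 2) (Fin 2) F) i j * ![(a : F), (b : F)] j =
      ![(c : F), (d : F)] i * (g : Matrix (Fin 2) (Fin 2) F) i j := by
    simpa only [mul_diagonal, diagonal_mul] using congrFun (congrFun hmul i) j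
  have cancel {x y z : F} (hx : x ≠ 0) (hxy : x * y = z * x) : y = z :=
    mul_left_cancel₀ hx (hxy.trans (mul_comm z x))
  have hdet : (g : Matrix (Fin 2) (Fin 2) F).det ≠ 0 :=
    ((isUnit_iff_isUnit_det _).mp g.isUnit).ne_zero
  rw [det_fin_two] at hdet
  by_cases hdiag : (g : Matrix (Fin 2) (Fin 2) F) 0 0 * (g : Matrix (Fin 2) (Fin 2) F) 1 1 = 0
  · rw [hdiag, zero_sub, neg_ne_zero] at hdet
    exact .inr ⟨Units.ext (cancel (right_ne_zero_of_mul hdet) (entry 1 0)),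
      Units.ext (cancel (left_ne_zero_of_mul hdet) (entry 0 1))⟩
  · exact .inl ⟨Units.ext (cancel (left_ne_zero_of_mul hdiag) (entry 0 0)),
      Units.ext (cancel (right_ne_zero_of_mul hdiag) (entry 1 1))⟩

/-- Conjugation by the permutation matrix of a transposition swaps the diagonal entries. -/
theorem exists_conj_diagGL_eq_swap (R : Type*) [CommRing R] :
    ∃ g : GL (Fin 2) R, ∀ a b : Rˣ, g * diagGL a b * g⁻¹ = diagGL b a := by
  have hsq : !![(0 : R), 1; 1, 0] * !![0, 1; 1, 0] = 1 := by
    simp [one_fin_two]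
  refine ⟨⟨!![0, 1; 1, 0], !![0, 1; 1, 0], hsq, hsq⟩, fun a b => ?_⟩
  rw [mul_inv_eq_iff_eq_mul]
  ext i j
  fin_cases i <;> fin_cases j <;> simp [diagGL, mul_apply]

theorem zpow_eq_zpow_iff_intCast_eq {G : Type*} [Group G] {x : G} {p : ℕ}
    (hx : orderOf x = p) (m n : ℤ) : x ^ m = x ^ n ↔ (m : ZMod p) = n := by
  rw [zpow_eq_zpow_iff_modEq, hx, ZMod.intCast_eq_intCast_iff]

theorem statement11 (p q : ℕ) (hp : p.Prime) (hq : q.Prime)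
    (hpq : p < q) (hq5 : 5 ≤ q)
    (h1 : p ∣ q - 1) (h2 : ¬ p ∣ q + 1) (h3 : ¬ p ^ 2 ∣ q - 1)
    -- `lam` is a generator of the unique subgroup of order `p` of `(ℤ/qℤ)*`
    (lam : (ZMod q)ˣ) (hlam : orderOf lam = p) (k l : ZMod p) :
    (∃ g : GL (Fin 2) (ZMod q),
      Subgroup.map (MulAut.conj g).toMonoidHom
          (Subgroup.zpowers (diagGL lam (lam ^ k.val))) =
        Subgroup.zpowers (diagGL lam (lam ^ l.val))) ↔
    (l = k ∨ k * l = 1) := by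
  have : Fact p.Prime := ⟨hp⟩
  have : Fact q.Prime := ⟨hq⟩
  have cast_val (x : ZMod p) : ((x.val : ℤ) : ZMod p) = x := by simp
  simp only [MonoidHom.map_zpowers, MulEquiv.coe_toMonoidHom, MulAut.conj_apply, ← zpow_natCast]
  constructor
  · rintro ⟨g, hg⟩
    obtain ⟨n, hn⟩ := Subgroup.mem_zpowers_iff.mp (hg ▸ Subgroup.mem_zpowers _)
    rw [diagGL_zpow, ← _root_.zpow_mul] at hn
    rcases eq_or_swap_of_conj_diagGL hn.symm with ⟨hfst, hsnd⟩ | ⟨hfst, hsnd⟩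
    · rw [zpow_eq_zpow_iff_intCast_eq hlam, Int.cast_mul, cast_val, cast_val] at hsnd
      nth_rw 1 [← zpow_one lam] at hfst
      rw [zpow_eq_zpow_iff_intCast_eq hlam, Int.cast_one] at hfst
      left
      rw [hsnd, ← hfst, mul_one]
    · rw [zpow_eq_zpow_iff_intCast_eq hlam, cast_val] at hsnd
      nth_rw 1 [← zpow_one lam] at hfst
      rw [zpow_eq_zpow_iff_intCast_eq hlam, Int.cast_mul, Int.cast_one, cast_val] at hfst
      right
      rw [hsnd, mul_comm, ← hfst]
  · rintro (rfl | hkl)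
    · exact ⟨1, by simp⟩
    · obtain ⟨g, hg⟩ := exists_conj_diagGL_eq_swap (ZMod q)
      have hlam_mul : (lam ^ (k.val : ℤ)) ^ (l.val : ℤ) = lam := by
        rw [← _root_.zpow_mul]
        nth_rw 2 [← zpow_one lam]
        rw [zpow_eq_zpow_iff_intCast_eq hlam, Int.cast_mul, cast_val, cast_val, hkl, Int.cast_one]
      refine ⟨g, ?_⟩
      rw [hg]
      apply le_antisymm <;> rw [Subgroup.zpowers_le, Subgroup.mem_zpowers_iff]
      · exact ⟨k.val, by rw [diagGL_zpow, zpow_comm lam l.val k.val, hlam_mul]⟩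
      · exact ⟨l.val, by rw [diagGL_zpow, hlam_mul]⟩
end

section
/- Let p and q be primes with q > p, q ≥ 5, p | q−1, p ∤ q+1 and p² ∤ q−1. Let G be a group of order p²·q² whose Sylow q-subgroup is cyclic (isomorphic to ℤ/q²ℤ) and whose Sylow p-subgroup is cyclic (isomorphic to ℤ/p²ℤ). Then either G is isomorphic to ℤ/(p²q²)ℤ, or G is isomorphic to the semidirect product (ℤ/q²ℤ) ⋊ (ℤ/p²ℤ) in which a generator of ℤ/p²ℤ acts on ℤ/q²ℤ as multiplication by α, where α is an element of order p of (ℤ/q²ℤ)*; explicitly, with multiplication (x₁,y₁)·(x₂,y₂) = (x₁ + α^{y₁}·x₂, y₁ + y₂). -/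
/-- In a finite cyclic group, any two elements of the same order generate the same subgroup. -/
theorem IsCyclic.mem_zpowers_of_orderOf_eq {C : Type*} [CommGroup C] [IsCyclic C] [Finite C]
    {u v : C} (h : orderOf u = orderOf v) : v ∈ Subgroup.zpowers u := by
  have hle : Subgroup.zpowers u ≤ (powMonoidHom (orderOf u) : C →* C).ker := by
    rw [Subgroup.zpowers_le, MonoidHom.mem_ker, powMonoidHom_apply, pow_orderOf_eq_one]
  have heq := Subgroup.eq_of_le_of_card_ge hle (by
    rw [IsCyclic.card_powMonoidHom_ker, Nat.card_zpowers,
      Nat.gcd_eq_right (orderOf_dvd_natCard u)])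
  rw [heq, MonoidHom.mem_ker, powMonoidHom_apply, h, pow_orderOf_eq_one]

theorem pow_eq_pow_iff_natCast_eq {G : Type*} [Group G] {a : G} {m : ℕ} (ha : orderOf a = m)
    (i j : ℕ) : a ^ i = a ^ j ↔ (i : ZMod m) = j := by
  rw [pow_eq_pow_iff_modEq, ha, ZMod.natCast_eq_natCast_iff]

theorem pow_mul_pow_mul_inv_of_conj_eq {G : Type*} [Group G] {a b : G} {n : ℕ}
    (h : b * a * b⁻¹ = a ^ n) (i j : ℕ) : b ^ j * a ^ i * (b ^ j)⁻¹ = a ^ (n ^ j * i) := by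
  induction j with
  | zero => simp
  | succ j ih =>
    have : b ^ (j + 1) * a ^ i * (b ^ (j + 1))⁻¹ = b * (b ^ j * a ^ i * (b ^ j)⁻¹) * b⁻¹ := by
      rw [pow_succ']; group
    rw [this, ih, ← conj_pow, h, ← pow_mul]
    congr 1
    ring

/-- A group of order `m * n`, with `m` and `n` coprime, generated by `a` of order `m` and `b` of
order `n` with `b * a * b⁻¹ = a ^ γ`, is the semidirect product of `ZMod m` and `ZMod n` in which
`1 : ZMod n` acts as multiplication by `γ`. -/
theorem exists_equiv_zmod_prod_of_conj_eq {G : Type*} [Group G] [Finite G] {m n : ℕ} [NeZero m]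
    [NeZero n] (hmn : m.Coprime n) (hG : Nat.card G = m * n) {a b : G} (ha : orderOf a = m)
    (hb : orderOf b = n) (γ : (ZMod m)ˣ) (hab : b * a * b⁻¹ = a ^ (γ : ZMod m).val) :
    ∃ e : G ≃ ZMod m × ZMod n, ∀ g h : G,
      e (g * h) = ((e g).1 + ((γ ^ ((e g).2).val : (ZMod m)ˣ) : ZMod m) * (e h).1,
        (e g).2 + (e h).2) := by
  let f : ZMod m × ZMod n → G := fun x ↦ a ^ x.1.val * b ^ x.2.val
  have hdisj : Disjoint (Subgroup.zpowers a) (Subgroup.zpowers b) := by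
    apply Subgroup.disjoint_of_coprime_natCard
    rwa [Nat.card_zpowers, Nat.card_zpowers, ha, hb]
  have hinj : Function.Injective f := by
    rintro ⟨x, y⟩ ⟨x', y'⟩ hxy
    have := Subgroup.mul_injective_of_disjoint hdisj
      (a₁ := (⟨a ^ x.val, Subgroup.npow_mem_zpowers a _⟩,
        ⟨b ^ y.val, Subgroup.npow_mem_zpowers b _⟩))
      (a₂ := (⟨a ^ x'.val, Subgroup.npow_mem_zpowers a _⟩,
        ⟨b ^ y'.val, Subgroup.npow_mem_zpowers b _⟩)) hxy
    simp only [Prod.mk.injEq, Subtype.mk.injEq, pow_eq_pow_iff_natCast_eq ha,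
      pow_eq_pow_iff_natCast_eq hb, ZMod.natCast_zmod_val] at this
    exact Prod.ext this.1 this.2
  have hbij : Function.Bijective f :=
    (Nat.bijective_iff_injective_and_card f).2 ⟨hinj, by simp [hG]⟩
  have hmul : ∀ x y : ZMod m × ZMod n,
      f x * f y = f (x.1 + ((γ ^ x.2.val : (ZMod m)ˣ) : ZMod m) * y.1, x.2 + y.2) := by
    rintro ⟨x, y⟩ ⟨x', y'⟩
    calc a ^ x.val * b ^ y.val * (a ^ x'.val * b ^ y'.val)
        = a ^ x.val * (b ^ y.val * a ^ x'.val * (b ^ y.val)⁻¹) * (b ^ y.val * b ^ y'.val) := by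
          group
      _ = a ^ (x.val + (γ : ZMod m).val ^ y.val * x'.val) * b ^ (y.val + y'.val) := by
          rw [pow_mul_pow_mul_inv_of_conj_eq hab, ← pow_add, ← pow_add]
      _ = _ := by
          refine congrArg₂ (· * ·) ((pow_eq_pow_iff_natCast_eq ha _ _).2 ?_)
            ((pow_eq_pow_iff_natCast_eq hb _ _).2 ?_) <;> simp
  refine ⟨(Equiv.ofBijective f hbij).symm, fun g h ↦ ?_⟩
  rw [Equiv.symm_apply_eq, Equiv.ofBijective_apply, ← hmul]
  simp only [← Equiv.ofBijective_apply f hbij, Equiv.apply_symm_apply]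

/-- A Sylow `q`-subgroup of index `p ^ 2`, with `p < q` prime and `q ≠ 3`, is normal. -/
theorem Sylow.normal_of_index_eq_sq {G : Type*} [Group G] [Finite G] {p q : ℕ}
    (hp : p.Prime) [hq : Fact q.Prime] (hpq : p < q) (hq3 : q ≠ 3) (Q : Sylow q G)
    (hQ : (Q : Subgroup G).index = p ^ 2) : (Q : Subgroup G).Normal := by
  have hdvd := Q.card_dvd_index
  have hmod := card_sylow_modEq_one q G
  rw [hQ, Nat.dvd_prime_pow hp] at hdvd
  obtain ⟨k, hk, hcard⟩ := hdvd
  rw [hcard] at hmod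
  have hp2 := hp.two_le
  have hone : Nat.card (Sylow q G) = 1 := by
    have hdvd := (Nat.modEq_iff_dvd' (Nat.one_le_pow k p hp.pos)).1 hmod.symm
    interval_cases k
    · simpa using hcard
    · rw [pow_one] at hdvd
      have := Nat.le_of_dvd (by omega) hdvd
      omega
    · exfalso
      rw [show p ^ 2 - 1 = (p + 1) * (p - 1) by simpa using Nat.sq_sub_sq p 1,
        hq.out.dvd_mul] at hdvd
      rcases hdvd with h | h
      · have hle := Nat.le_of_dvd (by omega) h
        obtain rfl : q = p + 1 := by omega
        rcases hp.eq_two_or_odd' with rfl | hodd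
        · exact hq3 rfl
        · have := hq.out.eq_two_or_odd'
          rcases this with h | h
          · omega
          · exact (Nat.not_even_iff_odd.2 h) hodd.add_one
      · have := Nat.le_of_dvd (by omega) h
        omega
  have : Subsingleton (Sylow q G) := (Nat.card_eq_one_iff_unique.1 hone).1
  exact Q.normal_of_subsingleton

theorem statement14 (p q : ℕ) (hp : p.Prime) (hq : q.Prime)
    (hpq : p < q) (hq5 : 5 ≤ q)
    (h1 : p ∣ q - 1) (h2 : ¬ p ∣ q + 1) (h3 : ¬ p ^ 2 ∣ q - 1)
    -- `α` is an element of order `p` of `(ℤ/q²ℤ)*` (a generator of its unique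
    -- subgroup of order `p`)
    (α : (ZMod (q ^ 2))ˣ) (hα : orderOf α = p)
    (G : Type) [Group G] [Finite G] (hG : Nat.card G = p ^ 2 * q ^ 2)
    (hSq : ∀ Q : Sylow q G, IsCyclic ↥(Q : Subgroup G))
    (hSp : ∀ P : Sylow p G, IsCyclic ↥(P : Subgroup G)) :
    Nonempty (G ≃* Multiplicative (ZMod (p ^ 2 * q ^ 2))) ∨
    ∃ e : G ≃ ZMod (q ^ 2) × ZMod (p ^ 2), ∀ g h : G,
      e (g * h) = ((e g).1 + ((α ^ ((e g).2).val : (ZMod (q ^ 2))ˣ) : ZMod (q ^ 2)) * (e h).1,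
        (e g).2 + (e h).2) := by
  have : Fact p.Prime := ⟨hp⟩
  have : Fact q.Prime := ⟨hq⟩
  have : NeZero (p ^ 2) := ⟨pow_ne_zero _ hp.ne_zero⟩
  have : NeZero (q ^ 2) := ⟨pow_ne_zero _ hq.ne_zero⟩
  have hcop : Nat.Coprime p q := (Nat.coprime_primes hp hq).2 hpq.ne
  obtain ⟨P⟩ : Nonempty (Sylow p G) := inferInstance
  obtain ⟨Q⟩ : Nonempty (Sylow q G) := inferInstance
  have hPcard : Nat.card P = p ^ 2 := by
    rw [P.card_eq_multiplicity, hG, Nat.factorization_mul (NeZero.ne _) (NeZero.ne _)]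
    simp [hp.factorization, hq.factorization, hpq.ne]
  have hQcard : Nat.card Q = q ^ 2 := by
    rw [Q.card_eq_multiplicity, hG, Nat.factorization_mul (NeZero.ne _) (NeZero.ne _)]
    simp [hp.factorization, hq.factorization, hpq.ne']
  have hQindex : (Q : Subgroup G).index = p ^ 2 := by
    have := (Q : Subgroup G).card_mul_index
    rw [hG, hQcard, mul_comm (p ^ 2)] at this
    exact Nat.eq_of_mul_eq_mul_left (Nat.pos_of_neZero _) this
  have hQnormal := Q.normal_of_index_eq_sq hp hpq (by omega) hQindex
  obtain ⟨a, haQ⟩ := (Subgroup.isCyclic_iff_exists_zpowers_eq_top _).1 (hSq Q)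
  obtain ⟨b, hbP⟩ := (Subgroup.isCyclic_iff_exists_zpowers_eq_top _).1 (hSp P)
  have ha : orderOf a = q ^ 2 := by rw [← Nat.card_zpowers, haQ, hQcard]
  have hb : orderOf b = p ^ 2 := by rw [← Nat.card_zpowers, hbP, hPcard]
  obtain ⟨n, hn⟩ : ∃ n : ℕ, b * a * b⁻¹ = a ^ n := by
    have hmem := hQnormal.conj_mem a (haQ ▸ Subgroup.mem_zpowers a) b
    rw [← haQ, ← mem_powers_iff_mem_zpowers] at hmem
    obtain ⟨n, hn⟩ := hmem
    exact ⟨n, hn.symm⟩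
  have hnpow : (n : ZMod (q ^ 2)) ^ (p ^ 2) = 1 := by
    have h := pow_mul_pow_mul_inv_of_conj_eq hn 1 (p ^ 2)
    rw [← hb, pow_orderOf_eq_one, hb, one_mul, inv_one, mul_one,
      pow_eq_pow_iff_natCast_eq ha] at h
    simpa using h.symm
  set u : (ZMod (q ^ 2))ˣ := Units.ofPowEqOne _ _ hnpow (NeZero.ne _)
  have hun : (u : ZMod (q ^ 2)) = n := rfl
  have hu_dvd : orderOf u ∣ p := by
    have hsq : orderOf u ∣ p ^ 2 := orderOf_dvd_of_pow_eq_one (Units.pow_ofPowEqOne _ _)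
    have hcardu : orderOf u ∣ q * (q - 1) := by
      have := orderOf_dvd_natCard u
      rwa [Nat.card_eq_fintype_card, ZMod.card_units_eq_totient, Nat.totient_prime_pow hq two_pos,
        show 2 - 1 = 1 from rfl, pow_one] at this
    obtain ⟨k, hk, hord⟩ := (Nat.dvd_prime_pow hp).1 hsq
    have hcardu' : orderOf u ∣ q - 1 := by
      rw [hord] at hcardu ⊢
      exact (hcop.pow_left k).dvd_of_dvd_mul_left hcardu
    rw [hord] at hcardu' ⊢
    interval_cases k
    · simp
    · simp
    · exact absurd hcardu' h3
  rcases (Nat.dvd_prime hp).1 hu_dvd with hu1 | hup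
  · left
    have hn1 : (n : ZMod (q ^ 2)) = 1 := by rw [← hun, orderOf_eq_one_iff.1 hu1, Units.val_one]
    have hcomm : Commute b a := by
      have : a ^ n = a ^ 1 := (pow_eq_pow_iff_natCast_eq ha _ _).2 (by simpa using hn1)
      rw [this, pow_one] at hn
      exact mul_inv_eq_iff_eq_mul.1 hn
    have hord : orderOf (b * a) = Nat.card G := by
      rw [hcomm.orderOf_mul_eq_mul_orderOf_of_coprime (by rw [ha, hb]; exact hcop.pow 2 2), ha, hb,
        hG]
    have := isCyclic_of_orderOf_eq_card _ hord
    exact ⟨mulEquivOfCyclicCardEq (by simp [hG])⟩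
  · right
    have hcyc : IsCyclic (ZMod (q ^ 2))ˣ := ZMod.isCyclic_units_of_prime_pow q hq (by omega) 2
    have hmem : α ∈ Subgroup.zpowers u := IsCyclic.mem_zpowers_of_orderOf_eq (hup.trans hα.symm)
    obtain ⟨k, hk⟩ : ∃ k : ℕ, u ^ k = α := mem_powers_iff_mem_zpowers.2 hmem
    have hpk : ¬ p ∣ k := by
      intro hdvd
      rw [← hup, orderOf_dvd_iff_pow_eq_one, hk, ← orderOf_eq_one_iff, hα] at hdvd
      exact hp.ne_one hdvd
    have hbk : orderOf (b ^ k) = p ^ 2 := by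
      rw [Nat.Coprime.orderOf_pow, hb]
      rw [hb]
      exact ((Nat.Prime.coprime_iff_not_dvd hp).2 hpk).pow_left 2
    refine exists_equiv_zmod_prod_of_conj_eq (hcop.symm.pow 2 2) (by rw [hG, mul_comm]) ha hbk α ?_
    have h := pow_mul_pow_mul_inv_of_conj_eq hn 1 k
    rw [pow_one] at h
    rw [h, pow_eq_pow_iff_natCast_eq ha, ← hk]
    simp [hun]
end

section
/- Let p be an odd prime and let B = ℤ/p²ℤ with the brace structure given by the standard addition and x ∘ y = x + y + p·x·y. Then a bijection f : B → B satisfies f(x+y) = f(x)+f(y) and f(x∘y) = f(x)∘f(y) for all x, y (i.e. f is a brace automorphism) if and only if there exists a unit k ∈ (ℤ/p²ℤ)* with k ≡ 1 (mod p) such that f(x) = k·x for all x. -/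
theorem ZMod.natCast_mul_eq_zero_iff_castHom_eq_zero {p : ℕ} (hp : p ≠ 0)
    (a : ZMod (p ^ 2)) :
    (p : ZMod (p ^ 2)) * a = 0 ↔
      ZMod.castHom (dvd_pow_self p two_ne_zero) (ZMod p) a = 0 := by
  obtain ⟨n, rfl⟩ := ZMod.intCast_surjective a
  rw [map_intCast, ZMod.intCast_zmod_eq_zero_iff_dvd n p, ← Int.cast_natCast, ← Int.cast_mul,
    ZMod.intCast_zmod_eq_zero_iff_dvd, Nat.cast_pow, pow_two]
  exact mul_dvd_mul_iff_left (by exact_mod_cast hp)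

theorem ZMod.map_eq_map_one_mul {n : ℕ} {f : ZMod n → ZMod n}
    (hf : ∀ x y, f (x + y) = f x + f y) (x : ZMod n) : f x = f 1 * x := by
  obtain ⟨m, rfl⟩ := ZMod.intCast_surjective x
  have h := map_zsmul (AddMonoidHom.mk' f hf) m 1
  simpa [mul_comm] using h

theorem statement16 (p : ℕ) (hp : p.Prime) (hodd : p ≠ 2)
    (f : ZMod (p ^ 2) → ZMod (p ^ 2)) :
    (Function.Bijective f ∧
     (∀ x y, f (x + y) = f x + f y) ∧
     (∀ x y, f (x + y + (p : ZMod (p ^ 2)) * x * y)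
        = f x + f y + (p : ZMod (p ^ 2)) * f x * f y)) ↔
    (∃ k : (ZMod (p ^ 2))ˣ,
      ZMod.castHom (dvd_pow_self p (two_ne_zero)) (ZMod p) (k : ZMod (p ^ 2)) = 1 ∧
      ∀ x, f x = (k : ZMod (p ^ 2)) * x) := by
  have key (k : ZMod (p ^ 2)) :
      (p : ZMod (p ^ 2)) * (k - 1) = 0 ↔
        ZMod.castHom (dvd_pow_self p two_ne_zero) (ZMod p) k = 1 := by
    rw [ZMod.natCast_mul_eq_zero_iff_castHom_eq_zero hp.ne_zero, map_sub, map_one, sub_eq_zero]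
  constructor
  · rintro ⟨hbij, hadd, hcirc⟩
    have hlin := ZMod.map_eq_map_one_mul hadd
    obtain ⟨y, hy⟩ := hbij.surjective 1
    rw [hlin] at hy
    refine ⟨Units.mkOfMulEqOne _ _ hy, (key _).1 ?_, hlin⟩
    have h := hcirc 1 1
    rw [hlin] at h
    rw [Units.val_mkOfMulEqOne]
    linear_combination (-y) * h - (p : ZMod (p ^ 2)) * (f 1 - 1) * hy
  · rintro ⟨k, hk, hf⟩
    obtain rfl : f = fun x => (k : ZMod (p ^ 2)) * x := funext hf
    refine ⟨k.mulLeft_bijective, fun x y => mul_add _ _ _, fun x y => ?_⟩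
    linear_combination (-(k : ZMod (p ^ 2)) * x * y) * (key k).2 hk
end

section
/- Let p be an odd prime and let B = ℤ/pℤ × ℤ/pℤ with the brace structure given by componentwise addition and (x₁,y₁) ∘ (x₂,y₂) = (x₁ + x₂ + y₁·y₂, y₁ + y₂). Then a bijection f : B → B satisfies f(u+v) = f(u)+f(v) and f(u∘v) = f(u)∘f(v) for all u, v (i.e. f is a brace automorphism) if and only if there exist d ∈ (ℤ/pℤ)* and b ∈ ℤ/pℤ such that f(x,y) = (d²·x + b·y, d·y) for all (x,y) ∈ B. -/
/-- An additive self-map of `ZMod p × ZMod p` is determined by its values on the standard basis. -/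
lemma map_eq_smul_add_smul_of_map_add {p : ℕ} {f : ZMod p × ZMod p → ZMod p × ZMod p}
    (hadd : ∀ u v, f (u + v) = f u + f v) (u : ZMod p × ZMod p) :
    f u = u.1 • f (1, 0) + u.2 • f (0, 1) := by
  have hsmul (c : ZMod p) (v : ZMod p × ZMod p) : f (c • v) = c • f v :=
    ZMod.map_smul (AddMonoidHom.mk' f hadd) c v
  rw [← hsmul, ← hsmul, ← hadd]
  congr 1
  ext <;> simp

theorem statement18 (p : ℕ) (hp : p.Prime) (hodd : p ≠ 2)
    (f : ZMod p × ZMod p → ZMod p × ZMod p) :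
    (Function.Bijective f ∧
     (∀ u v, f (u + v) = f u + f v) ∧
     (∀ u v, f (u.1 + v.1 + u.2 * v.2, u.2 + v.2)
        = ((f u).1 + (f v).1 + (f u).2 * (f v).2, (f u).2 + (f v).2))) ↔
    (∃ (d : (ZMod p)ˣ) (b : ZMod p),
      ∀ u : ZMod p × ZMod p,
        f u = ((d : ZMod p) ^ 2 * u.1 + b * u.2, (d : ZMod p) * u.2)) := by
  have : Fact p.Prime := ⟨hp⟩
  constructor
  · rintro ⟨hbij, hadd, hcirc⟩
    have hlin := map_eq_smul_add_smul_of_map_add hadd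
    have hbasis : f (1, 0) = ((f (0, 1)).2 ^ 2, 0) := by
      have h := hcirc (0, 1) (0, 1)
      rw [hlin] at h
      have h₁ := congrArg Prod.fst h
      have h₂ := congrArg Prod.snd h
      simp only [Prod.fst_add, Prod.snd_add, Prod.smul_fst, Prod.smul_snd, smul_eq_mul] at h₁ h₂
      ext
      · linear_combination h₁
      · linear_combination h₂
    have hd : (f (0, 1)).2 ≠ 0 := by
      intro h0
      have hzero : f 0 = 0 := by simpa using hadd 0 0
      have h : f (1, 0) = f 0 := by rw [hbasis, hzero, h0]; simp
      simpa using congrArg Prod.fst (hbij.injective h)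
    refine ⟨Units.mk0 _ hd, (f (0, 1)).1, fun u => ?_⟩
    rw [hlin u, hbasis]
    ext
    · simp [mul_comm]
    · simp [mul_comm]
  · rintro ⟨d, b, hf⟩
    refine ⟨Finite.injective_iff_bijective.mp fun u v huv => ?_, fun u v => ?_, fun u v => ?_⟩
    · rw [hf, hf, Prod.mk.injEq] at huv
      have hsnd : u.2 = v.2 := d.isUnit.mul_left_cancel huv.2
      have hfst := huv.1
      rw [hsnd, add_left_inj] at hfst
      exact Prod.ext ((d.isUnit.pow 2).mul_left_cancel hfst) hsnd
    · simp only [hf]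
      ext <;> simp <;> ring
    · simp only [hf]
      ext <;> simp only <;> ring
end

section
/- Let p and q be primes with q > p, q ≥ 5, p | q−1, p ∤ q+1 and p² ∤ q−1. Consider the set of group operations ∘ on B = ℤ/(p²q²)ℤ such that (B, +, ∘) is a left brace with the standard addition (i.e. (B,∘) is a group and x∘(y+z)+x = x∘y+x∘z for all x,y,z). Declare ∘₁ and ∘₂ equivalent if there is an additive automorphism f of ℤ/(p²q²)ℤ with f(x ∘₁ y) = f(x) ∘₂ f(y) for all x, y. Then the number of equivalence classes is exactly p + 4; that is, up to isomorphism there are exactly p + 4 left braces with additive group ℤ/(p²q²)ℤ. -/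
/-- The map `g` is multiplicative for the operation `x ∘ y = x + v x * y`. -/
def IsTwistedHom {S A : Type*} [CommRing S] [Mul A] (v : S → Sˣ) (g : S → A) : Prop :=
  ∀ x y, g (x + v x * y) = g x * g y

namespace IsTwistedHom

variable {S A : Type*} [CommRing S] [CommGroup A] {v : S → Sˣ} {g : S → A}

theorem map_zero (h : IsTwistedHom v g) : g 0 = 1 := by
  have := h 0 0
  simpa using this

theorem pow_card [Fintype S] (h : IsTwistedHom v g) (x : S) : g x ^ Fintype.card S = 1 := by
  have key := Equiv.prod_comp ((v x).mulLeft.trans (Equiv.addLeft x)) g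
  simp only [Equiv.trans_apply, Units.mulLeft_apply, Equiv.coe_addLeft, h x,
    Finset.prod_mul_distrib, Finset.prod_const, Finset.card_univ] at key
  simpa using key

theorem map_geom_sum (h : IsTwistedHom v g) (x : S) (n : ℕ) :
    g ((∑ i ∈ Finset.range n, (v x : S) ^ i) * x) = g x ^ n := by
  induction n with
  | zero => simp [h.map_zero]
  | succ n ih =>
    rw [geom_sum_succ, pow_succ', ← ih, ← h]
    congr 1
    ring

end IsTwistedHom

/-- Reduction modulo `p` on `ℤ/p²ℤ`. -/
def redSq (p : ℕ) : ZMod (p ^ 2) →+* ZMod p :=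
  ZMod.castHom (dvd_pow_self p two_ne_zero) (ZMod p)

theorem natCast_dvd_of_redSq_eq_zero {p : ℕ} [NeZero p] {x : ZMod (p ^ 2)}
    (h : redSq p x = 0) : (p : ZMod (p ^ 2)) ∣ x := by
  obtain ⟨n, rfl⟩ := ZMod.natCast_zmod_surjective x
  rw [map_natCast, ZMod.natCast_eq_zero_iff] at h
  exact_mod_cast Nat.cast_dvd_cast h

theorem natCast_sq_eq_zero (p : ℕ) : (p : ZMod (p ^ 2)) ^ 2 = 0 := by
  exact_mod_cast ZMod.natCast_self (p ^ 2)

theorem redSq_eq_one_iff {p : ℕ} (hp : p.Prime) (a : (ZMod (p ^ 2))ˣ) :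
    redSq p a = 1 ↔ a ^ p = 1 := by
  have := Fact.mk hp
  constructor
  · intro h
    have hd : (p : ZMod (p ^ 2)) ∣ (a : ZMod (p ^ 2)) - 1 :=
      natCast_dvd_of_redSq_eq_zero (by simp [h])
    have := dvd_sub_pow_of_dvd_sub hd 1
    rw [natCast_sq_eq_zero, zero_dvd_iff, pow_one, one_pow, sub_eq_zero] at this
    exact Units.ext (by simpa using this)
  · intro h
    have := congrArg (fun u : (ZMod (p ^ 2))ˣ => redSq p u) h
    simpa [ZMod.pow_card] using this

theorem geom_sum_eq_natCast {p : ℕ} (hp : p.Prime) (hp2 : p ≠ 2) {a : ZMod (p ^ 2)}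
    (h : redSq p a = 1) : ∑ i ∈ Finset.range p, a ^ i = p := by
  have := Fact.mk hp
  obtain ⟨s, hs⟩ : (p : ZMod (p ^ 2)) ∣ a - 1 := natCast_dvd_of_redSq_eq_zero (by simp [h])
  have hsq := natCast_sq_eq_zero p
  have hpow : ∀ i : ℕ, a ^ i = 1 + i * (p * s) := by
    intro i
    induction i with
    | zero => simp
    | succ i ih =>
      rw [pow_succ a, ih]
      push_cast
      linear_combination (1 + i * (p * s) : ZMod (p ^ 2)) * hs + (i * s ^ 2 : ZMod (p ^ 2)) * hsq
  have hodd : p ∣ ∑ i ∈ Finset.range p, i := by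
    have h2 : p ∣ (∑ i ∈ Finset.range p, i) * 2 := by
      rw [Finset.sum_range_id_mul_two]; exact dvd_mul_right _ _
    exact (Nat.Coprime.dvd_of_dvd_mul_right
      ((Nat.coprime_primes hp Nat.prime_two).mpr hp2) h2)
  obtain ⟨t, ht⟩ := hodd
  have ht' : ∑ i ∈ Finset.range p, (i : ZMod (p ^ 2)) = p * t := by
    rw [← Nat.cast_sum, ht, Nat.cast_mul]
  simp only [hpow, Finset.sum_add_distrib, ← Finset.sum_mul, ht']
  simp only [Finset.sum_const, Finset.card_range, nsmul_eq_mul, mul_one]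
  linear_combination (t * s : ZMod (p ^ 2)) * hsq

/-- Over `ℤ/p²ℤ` with `p` odd, a twisted homomorphism killed by `p` is a genuine one. -/
theorem IsTwistedHom.map_add {p : ℕ} (hp : p.Prime) (hp2 : p ≠ 2) {A : Type*} [CommGroup A]
    {v : ZMod (p ^ 2) → (ZMod (p ^ 2))ˣ} {g : ZMod (p ^ 2) → A}
    (hvp : ∀ x, v x ^ p = 1)
    (hg : IsTwistedHom v g) (hgp : ∀ x, g x ^ p = 1) (x y : ZMod (p ^ 2)) :
    g (x + y) = g x * g y := by
  have := Fact.mk hp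
  have hred : ∀ x, redSq p (v x) = 1 := fun x => (redSq_eq_one_iff hp _).mpr (hvp x)
  have hker : ∀ z, g (p * z) = 1 := fun z => by
    rw [← geom_sum_eq_natCast hp hp2 (hred z), hg.map_geom_sum, hgp]
  have hper : ∀ x z, g (x + p * z) = g x := fun x z => by
    obtain ⟨s, hs⟩ : (p : ZMod (p ^ 2)) ∣ v x - 1 :=
      natCast_dvd_of_redSq_eq_zero (by simp [hred])
    have := hg x (p * z)
    rw [hker, mul_one] at this
    rw [← this]
    congr 1
    linear_combination -(p * z) * hs - s * z * natCast_sq_eq_zero p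
  obtain ⟨s, hs⟩ : (p : ZMod (p ^ 2)) ∣ v x - 1 :=
    natCast_dvd_of_redSq_eq_zero (by simp [hred])
  rw [← hg, ← hper (x + y) (s * y)]
  congr 1
  linear_combination -y * hs

/-- A parametrization of the `r`-torsion of `A` by `ℤ/rℤ`. -/
structure IsTorsionParam {A : Type*} [CommGroup A] (r : ℕ) (e : ZMod r → A) : Prop where
  map_add : ∀ k l, e (k + l) = e k * e l
  injective : Function.Injective e
  pow_eq_one : ∀ k, e k ^ r = 1
  exists_eq : ∀ z, z ^ r = 1 → ∃ k, e k = z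

theorem exists_isTorsionParam {A : Type*} [CommGroup A] [Finite A] [IsCyclic A] {r : ℕ}
    (hr : 0 < r) (h : r ∣ Nat.card A) : ∃ e : ZMod r → A, IsTorsionParam r e := by
  classical
  have := NeZero.of_pos hr
  cases nonempty_fintype A
  obtain ⟨g₀, hg₀⟩ := IsCyclic.exists_ofOrder_eq_natCard (α := A)
  obtain ⟨d, hd⟩ := h
  have hd0 : d ≠ 0 := by
    rintro rfl
    exact Nat.card_pos.ne' hd
  obtain ⟨g, hg⟩ : ∃ g : A, orderOf g = r := ⟨g₀ ^ d, by
    rw [orderOf_pow, hg₀, hd, Nat.gcd_mul_left_left, Nat.mul_div_cancel _ (Nat.pos_of_ne_zero hd0)]⟩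
  have hinj : Function.Injective fun k : ZMod r => g ^ k.val := fun k l hkl => by
    refine ZMod.val_injective r (pow_injOn_Iio_orderOf (x := g) ?_ ?_ hkl) <;>
    · rw [hg]; exact ZMod.val_lt _
  have hpow : ∀ k : ZMod r, (g ^ k.val) ^ r = 1 := fun k => by
    rw [← pow_mul, mul_comm, pow_mul, orderOf_dvd_iff_pow_eq_one.mp hg.dvd, one_pow]
  refine ⟨fun k => g ^ k.val, ?_, hinj, hpow, ?_⟩
  · intro k l
    rw [ZMod.val_add, ← pow_add, ← pow_mod_orderOf g (k.val + l.val), hg]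
  · intro z hz
    have hsub : Finset.univ.image (fun k : ZMod r => g ^ k.val) ⊆
        Finset.univ.filter (fun a : A => a ^ r = 1) := by
      intro a ha
      obtain ⟨k, -, rfl⟩ := Finset.mem_image.mp ha
      simpa using hpow k
    have heq := Finset.eq_of_subset_of_card_le hsub (by
      rw [Finset.card_image_of_injective _ hinj, Finset.card_univ, ZMod.card]
      exact IsCyclic.card_pow_eq_one_le hr)
    have hz' : z ∈ Finset.univ.filter (fun a : A => a ^ r = 1) := by simpa using hz
    rw [← heq] at hz'
    obtain ⟨k, -, hk⟩ := Finset.mem_image.mp hz'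
    exact ⟨k, hk⟩

theorem IsTorsionParam.map_zero {A : Type*} [CommGroup A] {r : ℕ} {e : ZMod r → A}
    (he : IsTorsionParam r e) : e 0 = 1 := by
  simpa using he.map_add 0 0

theorem IsTorsionParam.exists_eq_of_map_add {A : Type*} [CommGroup A] {p : ℕ} [NeZero p]
    {e : ZMod p → A} (he : IsTorsionParam p e) {g : ZMod (p ^ 2) → A}
    (hg : ∀ x y, g (x + y) = g x * g y) (hgp : ∀ x, g x ^ p = 1) :
    ∃ k, ∀ x, g x = e (k * redSq p x) := by
  obtain ⟨k, hk⟩ := he.exists_eq (g 1) (hgp 1)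
  refine ⟨k, fun x => ?_⟩
  obtain ⟨n, rfl⟩ := ZMod.natCast_zmod_surjective x
  induction n with
  | zero => simpa [he.map_zero] using hg 0 0
  | succ n ih =>
    rw [Nat.cast_succ, hg, ih, _root_.map_add, map_one, mul_add, mul_one, he.map_add, hk]

theorem Nat.Prime.card_units_zmod_sq {p : ℕ} (hp : p.Prime) :
    Nat.card (ZMod (p ^ 2))ˣ = p * (p - 1) := by
  have := NeZero.of_pos hp.pos
  rw [Nat.card_eq_fintype_card, ZMod.card_units_eq_totient, Nat.totient_prime_pow hp two_pos]
  simp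

theorem pow_prime_eq_one_of_sq {A : Type*} [Group A] {p n : ℕ} (hp : p.Prime)
    (hn : ¬ p ^ 2 ∣ n) {a : A} (h : a ^ p ^ 2 = 1) (h' : a ^ n = 1) : a ^ p = 1 := by
  have hg := pow_gcd_eq_one.mpr ⟨h, h'⟩
  obtain ⟨i, hi, hi'⟩ := (Nat.dvd_prime_pow hp).mp (Nat.gcd_dvd_left (p ^ 2) n)
  have hi2 : i ≠ 2 := by
    rintro rfl
    exact hn (hi' ▸ Nat.gcd_dvd_right _ _)
  have hdvd : p ^ i ∣ p := by
    simpa using pow_dvd_pow p (show i ≤ 1 by omega)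
  rw [hi'] at hg
  exact orderOf_dvd_iff_pow_eq_one.mp ((orderOf_dvd_of_pow_eq_one hg).trans hdvd)

theorem Nat.Prime.not_sq_dvd_mul_pred {p : ℕ} (hp : p.Prime) : ¬ p ^ 2 ∣ p * (p - 1) := by
  rw [sq, Nat.mul_dvd_mul_iff_left hp.pos]
  intro h
  have := Nat.le_of_dvd (Nat.sub_pos_of_lt hp.one_lt) h
  have := hp.pos
  omega

section Classification

variable {p q : ℕ}

/-- The twist with parameters `(k, m, n)` on `ℤ/p²ℤ × ℤ/q²ℤ`, relative to parametrizations of the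
`p`-torsion and `q`-torsion of the unit groups. -/
def stdTwist (hpq : (p ^ 2).Coprime (q ^ 2)) (e₁ : ZMod p → (ZMod (p ^ 2))ˣ)
    (e₂ : ZMod p → (ZMod (q ^ 2))ˣ) (e₃ : ZMod q → (ZMod (q ^ 2))ˣ) (k m : ZMod p) (n : ZMod q)
    (x : ZMod (p ^ 2 * q ^ 2)) : (ZMod (p ^ 2 * q ^ 2))ˣ :=
  Units.map (ZMod.chineseRemainder hpq).symm.toMonoidHom (MulEquiv.prodUnits.symm
    (e₁ (k * redSq p (ZMod.chineseRemainder hpq x).1),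
      e₂ (m * redSq p (ZMod.chineseRemainder hpq x).1) *
        e₃ (n * redSq q (ZMod.chineseRemainder hpq x).2)))

variable {hpq : (p ^ 2).Coprime (q ^ 2)} {e₁ : ZMod p → (ZMod (p ^ 2))ˣ}
    {e₂ : ZMod p → (ZMod (q ^ 2))ˣ} {e₃ : ZMod q → (ZMod (q ^ 2))ˣ}

theorem chineseRemainder_stdTwist (k m : ZMod p) (n : ZMod q) (x : ZMod (p ^ 2 * q ^ 2)) :
    ZMod.chineseRemainder hpq (stdTwist hpq e₁ e₂ e₃ k m n x) =
      ((e₁ (k * redSq p (ZMod.chineseRemainder hpq x).1) : ZMod (p ^ 2)),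
        (e₂ (m * redSq p (ZMod.chineseRemainder hpq x).1) : ZMod (q ^ 2)) *
          e₃ (n * redSq q (ZMod.chineseRemainder hpq x).2)) := by
  simp [stdTwist, MulEquiv.prodUnits]

theorem isTwistedHom_stdTwist (hp : p.Prime) (hq : q.Prime) (h₁ : IsTorsionParam p e₁)
    (h₂ : IsTorsionParam p e₂) (h₃ : IsTorsionParam q e₃) {k m : ZMod p} {n : ZMod q}
    (hmn : m = 0 ∨ n = 0) :
    IsTwistedHom (stdTwist hpq e₁ e₂ e₃ k m n) (stdTwist hpq e₁ e₂ e₃ k m n) := by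
  intro x y
  apply Units.ext
  apply (ZMod.chineseRemainder hpq).injective
  rw [Units.val_mul, map_mul]
  simp only [chineseRemainder_stdTwist, map_add, map_mul, Prod.fst_add, Prod.fst_mul, Prod.snd_add,
    Prod.snd_mul, (redSq_eq_one_iff hp _).mpr (h₁.pow_eq_one _),
    (redSq_eq_one_iff hq _).mpr (h₃.pow_eq_one _), Prod.mk_mul_mk, one_mul, mul_one, mul_add,
    h₁.map_add, h₂.map_add, Units.val_mul]
  rcases hmn with rfl | rfl
  · simp [h₂.map_zero, h₃.map_add]
  · simp [h₃.map_zero]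

theorem exists_eq_stdTwist (hp : p.Prime) (hq : q.Prime) (hp2 : p ≠ 2) (hlt : p < q)
    (hsq : ¬ p ^ 2 ∣ q - 1) (h₁ : IsTorsionParam p e₁)
    (h₂ : IsTorsionParam p e₂) (h₃ : IsTorsionParam q e₃)
    {u : ZMod (p ^ 2 * q ^ 2) → (ZMod (p ^ 2 * q ^ 2))ˣ} (hu : IsTwistedHom u u) :
    ∃ k m n, (m = 0 ∨ n = 0) ∧ u = stdTwist hpq e₁ e₂ e₃ k m n := by
  have := NeZero.of_pos hp.pos
  have := NeZero.of_pos hq.pos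
  have := Fact.mk hq
  set E := ZMod.chineseRemainder hpq
  let w : ZMod (p ^ 2) → ZMod (q ^ 2) → (ZMod (p ^ 2))ˣ × (ZMod (q ^ 2))ˣ := fun x y =>
    MulEquiv.prodUnits (Units.map E.toMonoidHom (u (E.symm (x, y))))
  have hw : ∀ x y x' y', w (x + (w x y).1 * x') (y + (w x y).2 * y') = w x y * w x' y' := by
    intro x y x' y'
    have := hu (E.symm (x, y)) (E.symm (x', y'))
    simp only [w, ← map_mul, ← this]
    congr 3
    apply E.injective
    simp [MulEquiv.prodUnits]
    rfl
  have hα : ∀ x y x' y', (w (x + (w x y).1 * x') (y + (w x y).2 * y')).1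
      = (w x y).1 * (w x' y').1 := fun x y x' y' => by rw [hw]; rfl
  have hβ : ∀ x y x' y', (w (x + (w x y).1 * x') (y + (w x y).2 * y')).2
      = (w x y).2 * (w x' y').2 := fun x y x' y' => by rw [hw]; rfl
  have hα₁ : IsTwistedHom (fun x => (w x 0).1) (fun x => (w x 0).1) := fun x x' => by
    simpa using hα x 0 x' 0
  have hβ₁ : IsTwistedHom (fun x => (w x 0).1) (fun x => (w x 0).2) := fun x x' => by
    simpa using hβ x 0 x' 0
  have hα₂ : IsTwistedHom (fun y => (w 0 y).2) (fun y => (w 0 y).1) := fun y y' => by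
    simpa using hα 0 y 0 y'
  have hβ₂ : IsTwistedHom (fun y => (w 0 y).2) (fun y => (w 0 y).2) := fun y y' => by
    simpa using hβ 0 y 0 y'
  have hcardP : ∀ a : (ZMod (p ^ 2))ˣ, a ^ (p * (p - 1)) = 1 := fun a => by
    rw [← hp.card_units_zmod_sq]; exact pow_card_eq_one'
  have hcardQ : ∀ a : (ZMod (q ^ 2))ˣ, a ^ (q * (q - 1)) = 1 := fun a => by
    rw [← hq.card_units_zmod_sq]; exact pow_card_eq_one'
  have hcop : p.Coprime q := (Nat.coprime_primes hp hq).mpr hlt.ne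
  have hα₁p : ∀ x, (w x 0).1 ^ p = 1 := fun x =>
    pow_prime_eq_one_of_sq hp hp.not_sq_dvd_mul_pred
      (by simpa [ZMod.card] using hα₁.pow_card x) (hcardP _)
  have hβ₁p : ∀ x, (w x 0).2 ^ p = 1 := fun x =>
    pow_prime_eq_one_of_sq hp
      (fun h => hsq (Nat.Coprime.dvd_of_dvd_mul_left (Nat.Coprime.pow_left 2 hcop) h))
      (by simpa [ZMod.card] using hβ₁.pow_card x) (hcardQ _)
  have hβ₂q : ∀ y, (w 0 y).2 ^ q = 1 := fun y =>
    pow_prime_eq_one_of_sq hq hq.not_sq_dvd_mul_pred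
      (by simpa [ZMod.card] using hβ₂.pow_card y) (hcardQ _)
  have hα₂_one : ∀ y, (w 0 y).1 = 1 := fun y => by
    have hc : (q ^ 2).Coprime (p * (p - 1)) := by
      refine Nat.Coprime.pow_left 2 (Nat.Coprime.mul_right hcop.symm ?_)
      refine Nat.coprime_of_lt_prime ?_ ?_ hq
      · have := hp.two_le; omega
      · omega
    have := pow_gcd_eq_one.mpr ⟨by simpa [ZMod.card] using hα₂.pow_card y, hcardP (w 0 y).1⟩
    rwa [hc, pow_one] at this
  obtain ⟨k, hk⟩ := h₁.exists_eq_of_map_add (hα₁.map_add hp hp2 hα₁p hα₁p) hα₁p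
  obtain ⟨m, hm⟩ := h₂.exists_eq_of_map_add (hβ₁.map_add hp hp2 hα₁p hβ₁p) hβ₁p
  obtain ⟨n, hn⟩ := h₃.exists_eq_of_map_add
    (hβ₂.map_add hq (by have := hp.two_le; omega) hβ₂q hβ₂q) hβ₂q
  have hsplit : ∀ x y, w x y = w 0 y * w x 0 := fun x y => by
    have := hw 0 y x 0
    rw [hα₂_one] at this
    simpa using this
  refine ⟨k, m, n, ?_, ?_⟩
  · by_contra! hmn
    have h := hβ 1 0 0 1
    simp only [mul_zero, add_zero, zero_add, mul_one] at h
    rw [hsplit 1, Prod.snd_mul, mul_comm, mul_right_inj, hn, hn] at h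
    have h' := h₃.injective h
    rw [map_one] at h'
    have hred := mul_left_cancel₀ hmn.2 h'
    rw [redSq_eq_one_iff hq] at hred
    have := pow_gcd_eq_one.mpr ⟨hβ₁p 1, hred⟩
    rw [hcop, pow_one, hm, map_one, mul_one, ← h₂.map_zero] at this
    exact hmn.1 (h₂.injective this)
  · funext x
    apply Units.ext
    apply E.injective
    rw [chineseRemainder_stdTwist]
    have hx : w (E x).1 (E x).2 = MulEquiv.prodUnits (Units.map E.toMonoidHom (u x)) := by
      simp only [w, Prod.mk.eta, RingEquiv.symm_apply_apply]
    have hfst : (E (u x)).1 = ((w (E x).1 (E x).2).1 : ZMod (p ^ 2)) := by rw [hx]; rfl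
    have hsnd : (E (u x)).2 = ((w (E x).1 (E x).2).2 : ZMod (q ^ 2)) := by rw [hx]; rfl
    apply Prod.ext
    · rw [hfst, hsplit, Prod.fst_mul, hα₂_one, one_mul, hk]
    · rw [hsnd, hsplit, Prod.snd_mul, mul_comm, hm, hn, Units.val_mul]

theorem exists_stdTwist_mul_iff (hp : p.Prime) (hq : q.Prime) (h₁ : IsTorsionParam p e₁)
    (h₂ : IsTorsionParam p e₂) (h₃ : IsTorsionParam q e₃) (k m k' m' : ZMod p) (n n' : ZMod q) :
    (∃ a : (ZMod (p ^ 2 * q ^ 2))ˣ, ∀ x, stdTwist hpq e₁ e₂ e₃ k m n x =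
        stdTwist hpq e₁ e₂ e₃ k' m' n' ((a : ZMod (p ^ 2 * q ^ 2)) * x)) ↔
      ∃ (i : (ZMod p)ˣ) (j : (ZMod q)ˣ), k = k' * i ∧ m = m' * i ∧ n = n' * j := by
  have := NeZero.of_pos hp.pos
  have := NeZero.of_pos hq.pos
  set E := ZMod.chineseRemainder hpq
  constructor
  · rintro ⟨a, ha⟩
    let b := MulEquiv.prodUnits (Units.map E.toMonoidHom a)
    have hb : E a = ((b.1 : ZMod (p ^ 2)), (b.2 : ZMod (q ^ 2))) := rfl
    have key : ∀ s t, e₁ (k * redSq p s) = e₁ (k' * (redSq p b.1 * redSq p s)) ∧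
        e₂ (m * redSq p s) * e₃ (n * redSq q t) =
          e₂ (m' * (redSq p b.1 * redSq p s)) * e₃ (n' * (redSq q b.2 * redSq q t)) := by
      intro s t
      have := congrArg (fun v : (ZMod (p ^ 2 * q ^ 2))ˣ => E v) (ha (E.symm (s, t)))
      simp only [E, chineseRemainder_stdTwist] at this
      rw [map_mul] at this
      change _ = (((e₁ (k' * redSq p (E a * E (E.symm (s, t))).1) : ZMod (p ^ 2)),
        (e₂ (m' * redSq p (E a * E (E.symm (s, t))).1) : ZMod (q ^ 2)) *
          e₃ (n' * redSq q (E a * E (E.symm (s, t))).2))) at this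
      rw [hb, RingEquiv.apply_symm_apply] at this
      simp only [Prod.mk_mul_mk, map_mul, Prod.mk.injEq] at this
      exact ⟨Units.ext this.1, Units.ext (by simpa using this.2)⟩
    refine ⟨Units.map (redSq p).toMonoidHom b.1, Units.map (redSq q).toMonoidHom b.2, ?_, ?_, ?_⟩
    · simpa using h₁.injective (key 1 0).1
    · have := (key 1 0).2
      simp only [map_zero, mul_zero, h₃.map_zero, mul_one, map_one] at this
      simpa using h₂.injective this
    · have := (key 0 1).2
      simp only [map_zero, mul_zero, h₂.map_zero, one_mul, mul_one, map_one] at this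
      simpa using h₃.injective this
  · rintro ⟨i, j, rfl, rfl, rfl⟩
    obtain ⟨i', rfl⟩ := ZMod.unitsMap_surjective (dvd_pow_self p two_ne_zero) i
    obtain ⟨j', rfl⟩ := ZMod.unitsMap_surjective (dvd_pow_self q two_ne_zero) j
    refine ⟨Units.map E.symm.toMonoidHom (MulEquiv.prodUnits.symm (i', j')), fun x => ?_⟩
    apply Units.ext
    apply E.injective
    have hE : E (Units.map E.symm.toMonoidHom (MulEquiv.prodUnits.symm (i', j')) :
        (ZMod (p ^ 2 * q ^ 2))ˣ) = ((i' : ZMod (p ^ 2)), (j' : ZMod (q ^ 2))) := by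
      simp [MulEquiv.prodUnits]
    rw [chineseRemainder_stdTwist, chineseRemainder_stdTwist, map_mul, hE]
    simp only [Prod.fst_mul, Prod.snd_mul, map_mul, mul_assoc]
    rfl

end Classification

section BraceOperations

variable {N : ℕ}

theorem AddMonoidHom.apply_zmod (f : ZMod N →+ ZMod N) (x : ZMod N) : f x = f 1 * x := by
  obtain ⟨n, rfl⟩ := ZMod.intCast_surjective x
  have := map_zsmul f n 1
  simpa [mul_comm] using this

theorem AddEquiv.exists_unit_zmod (f : ZMod N ≃+ ZMod N) :
    ∃ a : (ZMod N)ˣ, ∀ x, f x = a * x := by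
  have hf := f.toAddMonoidHom.apply_zmod
  have hg := f.symm.toAddMonoidHom.apply_zmod
  simp only [AddEquiv.toAddMonoidHom_eq_coe, AddMonoidHom.coe_coe] at hf hg
  have h : f 1 * f.symm 1 = 1 := by rw [← hf, f.apply_symm_apply]
  exact ⟨⟨f 1, f.symm 1, h, by rw [mul_comm, h]⟩, hf⟩

/-- The operation `c` makes `(ℤ/Nℤ, +, c)` a left brace. -/
abbrev IsBraceOp (c : ZMod N → ZMod N → ZMod N) : Prop :=
  (∀ x y z, c (c x y) z = c x (c y z)) ∧
    (∀ x, c 0 x = x) ∧ (∀ x, c x 0 = x) ∧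
    (∀ x, ∃ y, c x y = 0 ∧ c y x = 0) ∧
    (∀ x y z, c x (y + z) + x = c x y + c x z)

theorem IsTwistedHom.isBraceOp {u : ZMod N → (ZMod N)ˣ} (hu : IsTwistedHom u u) :
    IsBraceOp fun x y => x + u x * y := by
  refine ⟨fun x y z => ?_, fun x => ?_, fun x => ?_, fun x => ?_, fun x y z => ?_⟩
  · simp only [hu x y, Units.val_mul]
    ring
  · simp [hu.map_zero]
  · simp
  · have hx : x + u x * (-(↑(u x)⁻¹ * x)) = 0 := by simp
    have h := hu x (-(↑(u x)⁻¹ * x))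
    rw [hx, hu.map_zero] at h
    refine ⟨-(↑(u x)⁻¹ * x), hx, ?_⟩
    simp only [← inv_eq_of_mul_eq_one_right h.symm, neg_add_cancel]
  · ring

theorem IsBraceOp.exists_twist {c : ZMod N → ZMod N → ZMod N} (hc : IsBraceOp c) :
    ∃ u : ZMod N → (ZMod N)ˣ, IsTwistedHom u u ∧ c = fun x y => x + u x * y := by
  obtain ⟨hassoc, hzero, hzero', hinv, hdist⟩ := hc
  let v : ZMod N → ZMod N := fun x => c x 1 - x
  have hv : ∀ x y, c x y = x + v x * y := fun x y => by
    let f : ZMod N →+ ZMod N := AddMonoidHom.mk' (fun y => c x y - x) fun y z => by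
      linear_combination hdist x y z
    have := f.apply_zmod y
    exact sub_eq_iff_eq_add'.mp this
  have hmul : ∀ x y, v (x + v x * y) = v x * v y := fun x y => by
    have h := hassoc x y 1
    simp only [hv] at h
    linear_combination h
  have hone : v 0 = 1 := by simp [v, hzero]
  have hinv' : ∀ x, ∃ y, v x * v y = 1 := fun x => by
    obtain ⟨y, hy, -⟩ := hinv x
    exact ⟨y, by rw [← hmul, ← hv, hy, hone]⟩
  choose i hi using hinv'
  refine ⟨fun x => ⟨v x, v (i x), hi x, by rw [mul_comm, hi x]⟩, fun x y => ?_, ?_⟩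
  · exact Units.ext (hmul x y)
  · funext x y
    exact hv x y

theorem exists_addEquiv_iff_exists_unit (u u' : ZMod N → (ZMod N)ˣ) :
    (∃ f : ZMod N ≃+ ZMod N, ∀ x y, f (x + u x * y) = f x + u' (f x) * f y) ↔
      ∃ a : (ZMod N)ˣ, ∀ x, u x = u' (a * x) := by
  constructor
  · rintro ⟨f, hf⟩
    obtain ⟨a, ha⟩ := f.exists_unit_zmod
    refine ⟨a, fun x => Units.ext ?_⟩
    have h := hf x 1
    simp only [ha] at h
    apply a.isUnit.mul_left_cancel
    linear_combination h
  · rintro ⟨a, ha⟩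
    refine ⟨{ a.mulLeft with map_add' := mul_add (a : ZMod N) }, fun x y => ?_⟩
    change (a : ZMod N) * (x + u x * y) = a * x + u' (a * x) * (a * y)
    rw [← ha]
    ring

theorem equivalence_exists_addEquiv :
    Equivalence fun c₁ c₂ : {c : ZMod N → ZMod N → ZMod N // IsBraceOp c} =>
      ∃ f : ZMod N ≃+ ZMod N, ∀ x y, f (c₁.1 x y) = c₂.1 (f x) (f y) where
  refl _ := ⟨AddEquiv.refl _, fun _ _ => rfl⟩
  symm := fun ⟨f, hf⟩ => ⟨f.symm, fun x y => by
    rw [f.symm_apply_eq, hf, f.apply_symm_apply, f.apply_symm_apply]⟩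
  trans := fun ⟨f, hf⟩ ⟨g, hg⟩ => ⟨f.trans g, fun x y => by simp [hf, hg]⟩

end BraceOperations

/-- Representatives of the orbits of parameters `(k, m, n)` with `m = 0` or `n = 0`. -/
def orbitRep (p q : ℕ) : (Bool × Bool) ⊕ ZMod p → ZMod p × ZMod p × ZMod q
  | .inl (b, b') => (if b then 1 else 0, 0, if b' then 1 else 0)
  | .inr k => (k, 1, 0)

theorem orbitRep_valid (p q : ℕ) (t : (Bool × Bool) ⊕ ZMod p) :
    (orbitRep p q t).2.1 = 0 ∨ (orbitRep p q t).2.2 = 0 := by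
  rcases t with ⟨b, b'⟩ | k <;> simp [orbitRep]

theorem exists_eq_ite_mul_unit {F : Type*} [Field F] [DecidableEq F] (x : F) :
    ∃ (b : Bool) (i : Fˣ), (if b then 1 else 0) = x * i := by
  by_cases hx : x = 0
  · exact ⟨false, 1, by simp [hx]⟩
  · exact ⟨true, (Units.mk0 x hx)⁻¹, by simp [hx]⟩

theorem exists_orbitRep {p q : ℕ} [Fact p.Prime] [Fact q.Prime] (k m : ZMod p) (n : ZMod q)
    (h : m = 0 ∨ n = 0) : ∃ (t : (Bool × Bool) ⊕ ZMod p) (i : (ZMod p)ˣ) (j : (ZMod q)ˣ),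
      (orbitRep p q t).1 = k * i ∧ (orbitRep p q t).2.1 = m * i ∧
        (orbitRep p q t).2.2 = n * j := by
  by_cases hm : m = 0
  · obtain ⟨b, i, hi⟩ := exists_eq_ite_mul_unit k
    obtain ⟨b', j, hj⟩ := exists_eq_ite_mul_unit n
    exact ⟨.inl (b, b'), i, j, hi, by simp [orbitRep, hm], hj⟩
  · obtain rfl := h.resolve_left hm
    exact ⟨.inr (k * m⁻¹), (Units.mk0 m hm)⁻¹, 1, by simp [orbitRep], by simp [orbitRep, hm],
      by simp [orbitRep]⟩

theorem orbitRep_injective_of_orbit {p q : ℕ} [Fact p.Prime] [Fact q.Prime]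
    {t t' : (Bool × Bool) ⊕ ZMod p} {i : (ZMod p)ˣ} {j : (ZMod q)ˣ}
    (hk : (orbitRep p q t).1 = (orbitRep p q t').1 * i)
    (hm : (orbitRep p q t).2.1 = (orbitRep p q t').2.1 * i)
    (hn : (orbitRep p q t).2.2 = (orbitRep p q t').2.2 * j) : t = t' := by
  have hi := i.ne_zero
  have hj := j.ne_zero
  rcases t with ⟨b, c⟩ | k <;> rcases t' with ⟨b', c'⟩ | k'
  · revert hk hn
    cases b <;> cases b' <;> cases c <;> cases c' <;> simp [orbitRep, hi.symm, hj.symm]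
  · simp [orbitRep, hi.symm] at hm
  · simp [orbitRep] at hm
  · simp only [orbitRep, one_mul] at hk hm
    rw [hk, ← hm, mul_one]

theorem statement19 (p q : ℕ) (hp : p.Prime) (hq : q.Prime)
    (hpq : p < q) (hq5 : 5 ≤ q)
    (h1 : p ∣ q - 1) (h2 : ¬ p ∣ q + 1) (h3 : ¬ p ^ 2 ∣ q - 1) :
    -- the isomorphism classes of left braces with additive group `ℤ/p²q²ℤ`:
    -- group operations `c` making `(ℤ/p²q²ℤ, +, c)` a left brace, up to
    -- conjugation by an additive automorphism; there are exactly `p + 4` of them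
    Nat.card (Quot (fun c₁ c₂ :
        {c : ZMod (p ^ 2 * q ^ 2) → ZMod (p ^ 2 * q ^ 2) → ZMod (p ^ 2 * q ^ 2) //
          (∀ x y z, c (c x y) z = c x (c y z)) ∧
          (∀ x, c 0 x = x) ∧ (∀ x, c x 0 = x) ∧
          (∀ x, ∃ y, c x y = 0 ∧ c y x = 0) ∧
          (∀ x y z, c x (y + z) + x = c x y + c x z)} =>
      ∃ f : ZMod (p ^ 2 * q ^ 2) ≃+ ZMod (p ^ 2 * q ^ 2),
        ∀ x y, f (c₁.1 x y) = c₂.1 (f x) (f y))) = p + 4 := by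
  have := Fact.mk hp
  have := Fact.mk hq
  have hp2 : p ≠ 2 := by
    rintro rfl
    omega
  have hq2 : q ≠ 2 := by omega
  have hcop : (p ^ 2).Coprime (q ^ 2) :=
    Nat.Coprime.pow 2 2 ((Nat.coprime_primes hp hq).mpr hpq.ne)
  have := ZMod.isCyclic_units_of_prime_pow p hp hp2 2
  have := ZMod.isCyclic_units_of_prime_pow q hq hq2 2
  obtain ⟨e₁, he₁⟩ := exists_isTorsionParam (A := (ZMod (p ^ 2))ˣ) hp.pos
    (hp.card_units_zmod_sq ▸ dvd_mul_right _ _)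
  obtain ⟨e₂, he₂⟩ := exists_isTorsionParam (A := (ZMod (q ^ 2))ˣ) hp.pos
    (hq.card_units_zmod_sq ▸ h1.mul_left _)
  obtain ⟨e₃, he₃⟩ := exists_isTorsionParam (A := (ZMod (q ^ 2))ˣ) hq.pos
    (hq.card_units_zmod_sq ▸ dvd_mul_right _ _)
  let u := fun t : (Bool × Bool) ⊕ ZMod p => stdTwist hcop e₁ e₂ e₃ (orbitRep p q t).1
    (orbitRep p q t).2.1 (orbitRep p q t).2.2
  let op : (Bool × Bool) ⊕ ZMod p → {c // IsBraceOp (N := p ^ 2 * q ^ 2) c} := fun t =>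
    ⟨fun x y => x + u t x * y,
      (isTwistedHom_stdTwist hp hq he₁ he₂ he₃ (orbitRep_valid p q t)).isBraceOp⟩
  have hbij : Function.Bijective fun t => Quot.mk (fun c₁ c₂ :
      {c : ZMod (p ^ 2 * q ^ 2) → ZMod (p ^ 2 * q ^ 2) → ZMod (p ^ 2 * q ^ 2) // IsBraceOp c} =>
      ∃ f : ZMod (p ^ 2 * q ^ 2) ≃+ ZMod (p ^ 2 * q ^ 2),
        ∀ x y, f (c₁.1 x y) = c₂.1 (f x) (f y)) (op t) := by
    constructor
    · intro t t' htt
      have hrel := equivalence_exists_addEquiv.eqvGen_iff.mp (Quot.eqvGen_exact htt)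
      obtain ⟨i, j, hk, hm, hn⟩ := (exists_stdTwist_mul_iff hp hq he₁ he₂ he₃ _ _ _ _ _ _).mp
        ((exists_addEquiv_iff_exists_unit (u t) (u t')).mp hrel)
      exact orbitRep_injective_of_orbit hk hm hn
    · rintro ⟨c, hc⟩
      obtain ⟨v, hv, rfl⟩ := IsBraceOp.exists_twist hc
      obtain ⟨k, m, n, hmn, rfl⟩ := exists_eq_stdTwist (hpq := hcop) hp hq hp2 hpq h3 he₁ he₂ he₃ hv
      obtain ⟨t, h⟩ := exists_orbitRep k m n hmn
      exact ⟨t, Quot.sound ((exists_addEquiv_iff_exists_unit (u t) _).mpr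
        ((exists_stdTwist_mul_iff hp hq he₁ he₂ he₃ _ _ _ _ _ _).mpr h))⟩
  refine (Nat.card_congr (Equiv.ofBijective _ hbij)).symm.trans ?_
  simp [Nat.card_eq_fintype_card, ZMod.card, add_comm]
end
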